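/- A fullerene graph whose minimum pentagonal ring length equals 11 is not 3-resonant. -/

import Mathlib

open SimpleGraph

/-- The set of vertices incident with some edge of a face boundary. -/
def faceVerts (f : Finset (Sym2 V)) : Set V := {v | ∃ e ∈ f, v ∈ e}

/-- `G` has a perfect matching. -/
def HasPM (G : SimpleGraph V) : Prop := ∃ M : G.Subgraph, M.IsPerfectMatching

/-- Number of odd connected components of `G`. -/
noncomputable def oddComponents (G : SimpleGraph V) : ℕ :=
  Nat.card {c : G.ConnectedComponent // Odd (Nat.card c.supp)}

/-- `G` is cyclically `k`-edge-connected: no set of fewer than `k` edges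
separates `G` into two parts each containing a cycle. -/
def CycEdgeConn (G : SimpleGraph V) (k : ℕ) : Prop :=
  ∀ D : Finset (Sym2 V), D.card < k →
    ¬ ∃ A : Set V, (∀ a ∈ A, ∀ b ∉ A, ¬ (G.deleteEdges (↑D : Set (Sym2 V))).Adj a b) ∧
      ¬ (G.induce A).IsAcyclic ∧ ¬ (G.induce Aᶜ).IsAcyclic

/-- A combinatorial fullerene: a cubic, 3-connected plane graph presented together with
its face boundaries (as edge sets of boundary cycles), every face a pentagon or a
hexagon, each edge on exactly two faces, Euler's formula, and exactly 12 pentagons. -/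
structure IsFullerene [Fintype V] [DecidableEq V] (G : SimpleGraph V)
    (faces : Finset (Finset (Sym2 V))) : Prop where
  cubic : ∀ v : V, (G.neighborSet v).ncard = 3
  card_ge : 4 ≤ Fintype.card V
  threeConnected : ∀ s : Set V, s.ncard ≤ 2 → (G.induce sᶜ).Connected
  face_cycle : ∀ f ∈ faces, ∃ (v : V) (c : G.Walk v v), c.IsCycle ∧ c.edges.toFinset = f
  face_size : ∀ f ∈ faces, f.card = 5 ∨ f.card = 6
  edge_two_faces : ∀ e ∈ G.edgeSet, (faces.filter (fun f => e ∈ f)).card = 2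
  euler : Fintype.card V + faces.card = G.edgeSet.ncard + 2
  pentagons : (faces.filter (fun f => f.card = 5)).card = 12
/-- The face `f` is `M`-alternating: every vertex of `f` is matched by `M`
along an edge of `f`. -/
def AltFace (G : SimpleGraph V) (M : G.Subgraph) (f : Finset (Sym2 V)) : Prop :=
  ∀ v ∈ faceVerts f, ∃ u, s(v, u) ∈ f ∧ M.Adj v u

/-- A set of (disjoint hexagonal) faces is a resonant pattern if some perfect matching
of `G` is alternating on all of them. -/
def IsResonantPattern (G : SimpleGraph V) (H : Finset (Finset (Sym2 V))) : Prop :=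
  ∃ M : G.Subgraph, M.IsPerfectMatching ∧ ∀ f ∈ H, AltFace G M f

/-- `G` (with face set `faces`) is `k`-resonant. -/
def KResonant [Fintype V] [DecidableEq V] (G : SimpleGraph V)
    (faces : Finset (Finset (Sym2 V))) (k : ℕ) : Prop :=
  ∀ H : Finset (Finset (Sym2 V)), H ⊆ faces → (∀ f ∈ H, f.card = 6) →
    (∀ f ∈ H, ∀ g ∈ H, f ≠ g → Disjoint (faceVerts f) (faceVerts g)) →
    H.card ≤ k → IsResonantPattern G H
/-- A pentagonal ring of length `l`: a cyclic sequence of pentagonal faces,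
consecutive faces sharing exactly one edge, non-consecutive faces vertex-disjoint,
and the shared edges forming a matching. -/
def IsPentagonalRing [DecidableEq V] (faces : Finset (Finset (Sym2 V)))
    (l : ℕ) (ring : ZMod l → Finset (Sym2 V)) : Prop :=
  3 ≤ l ∧ Function.Injective ring ∧
  (∀ i, ring i ∈ faces ∧ (ring i).card = 5) ∧
  (∀ i, ∃ e, ring i ∩ ring (i + 1) = {e}) ∧
  (∀ i j : ZMod l, j ≠ i → j ≠ i + 1 → j ≠ i - 1 →
    Disjoint (faceVerts (ring i)) (faceVerts (ring j))) ∧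
  (∀ i j : ZMod l, i ≠ j → ∀ e ∈ ring i ∩ ring (i + 1), ∀ e' ∈ ring j ∩ ring (j + 1),
    ∀ v : V, v ∈ e → v ∉ e')

set_option synthInstance.maxHeartbeats 400000 in
set_option synthInstance.maxSize 100000 in
/-- The cyclic words of length `11` with at most five letters `true` and without the given
forbidden factors form a single orbit under rotation. -/
theorem ring_word : ∀ t : ZMod 11 → Bool, (Finset.univ.filter fun i => t i = true).card ≤ 5 →
    (∀ k, ¬ (t (0 + k) = false ∧ t (1 + k) = false ∧ t (2 + k) = false ∧ t (3 + k) = false)) →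
    (∀ k, ¬ (t (0 + k) = true ∧ t (1 + k) = false ∧ t (2 + k) = false ∧ t (3 + k) = false ∧
      t (4 + k) = true)) →
    (∀ k, ¬ (t (0 + k) = true ∧ t (1 + k) = false ∧ t (2 + k) = false ∧ t (3 + k) = true ∧
      t (4 + k) = false ∧ t (5 + k) = false ∧ t (6 + k) = true)) →
    (∀ k, ¬ (t (0 + k) = true ∧ t (1 + k) = false ∧ t (2 + k) = false ∧ t (3 + k) = true ∧
      t (4 + k) = false ∧ t (5 + k) = true ∧ t (9 + k) = true ∧ t (10 + k) = false)) →
    (∀ k, ¬ (t (0 + k) = true ∧ t (1 + k) = false ∧ t (2 + k) = false ∧ t (3 + k) = true ∧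
      t (4 + k) = false ∧ t (5 + k) = true ∧ t (6 + k) = false ∧ t (7 + k) = false ∧
      t (8 + k) = true)) →
    ∃ k, t (0 + k) = true ∧ t (1 + k) = false ∧ t (2 + k) = false ∧ t (3 + k) = true ∧
      t (4 + k) = true ∧ t (5 + k) = false ∧ t (6 + k) = false ∧ t (7 + k) = true ∧
      t (8 + k) = false ∧ t (9 + k) = true ∧ t (10 + k) = false := by
  decide +kernel

namespace IsFullerene

section Local

variable {V : Type*} [Fintype V] [DecidableEq V] {G : SimpleGraph V}
  {faces : Finset (Finset (Sym2 V))}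

theorem face_adj (hF : IsFullerene G faces) {f : Finset (Sym2 V)} (hf : f ∈ faces) {u v : V}
    (h : s(u, v) ∈ f) : G.Adj u v := by
  obtain ⟨x, c, -, rfl⟩ := hF.face_cycle f hf
  exact c.adj_of_mem_edges (by simpa using h)

/-- A face boundary, read off starting from any of its edges. -/
theorem face_cyclic (hF : IsFullerene G faces) {f : Finset (Sym2 V)} (hf : f ∈ faces) {a b : V}
    (h : s(a, b) ∈ f) :
    (f.card = 5 ∧ ∃ c d e, [a, b, c, d, e].Nodup ∧
      f = {s(a, b), s(b, c), s(c, d), s(d, e), s(e, a)}) ∨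
    (f.card = 6 ∧ ∃ c d e k, [a, b, c, d, e, k].Nodup ∧
      f = {s(a, b), s(b, c), s(c, d), s(d, e), s(e, k), s(k, a)}) := by
  obtain ⟨x, c₀, hc₀, hf₀⟩ := hF.face_cycle f hf
  have ha : a ∈ c₀.support := c₀.fst_mem_support_of_mem_edges (by rw [← hf₀] at h; simpa using h)
  obtain ⟨c, hc, hcf⟩ : ∃ c : G.Walk a a, c.IsCycle ∧ c.edges.toFinset = f :=
    ⟨c₀.rotate a ha, hc₀.rotate ha, by
      rw [← hf₀]; ext e; simp [(c₀.rotate_edges a ha).mem_iff]⟩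
  have hlen : c.length = f.card := by
    rw [← hcf, List.toFinset_card_of_nodup hc.edges_nodup, Walk.length_edges]
  have hnd := hc.support_nodup
  subst hcf
  rcases hF.face_size _ hf with h5 | h6
  · left
    refine ⟨h5, ?_⟩
    rw [h5] at hlen
    match c, hlen with
    | .cons (v := b') _ (.cons (v := c') _ (.cons (v := d') _ (.cons (v := e') _
        (.cons _ .nil)))), _ =>
      simp only [Walk.support_cons, Walk.support_nil, List.tail_cons, List.nodup_cons,
        List.mem_cons, List.not_mem_nil, or_false, not_or] at hnd
      simp only [Walk.edges_cons, Walk.edges_nil, List.toFinset_cons, List.toFinset_nil,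
        insert_empty_eq, Finset.mem_insert, Finset.mem_singleton, Sym2.eq_iff] at h ⊢
      have hb : b = b' ∨ b = e' := by grind
      rcases hb with rfl | rfl
      · exact ⟨c', d', e', by simp; grind, rfl⟩
      · refine ⟨d', c', b', by simp; grind, ?_⟩
        ext z
        simp only [Finset.mem_insert, Finset.mem_singleton]
        grind [Sym2.eq_swap]
  · right
    refine ⟨h6, ?_⟩
    rw [h6] at hlen
    match c, hlen with
    | .cons (v := b') _ (.cons (v := c') _ (.cons (v := d') _ (.cons (v := e') _
        (.cons (v := k') _ (.cons _ .nil))))), _ =>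
      simp only [Walk.support_cons, Walk.support_nil, List.tail_cons, List.nodup_cons,
        List.mem_cons, List.not_mem_nil, or_false, not_or] at hnd
      simp only [Walk.edges_cons, Walk.edges_nil, List.toFinset_cons, List.toFinset_nil,
        insert_empty_eq, Finset.mem_insert, Finset.mem_singleton, Sym2.eq_iff] at h ⊢
      have hb : b = b' ∨ b = k' := by grind
      rcases hb with rfl | rfl
      · exact ⟨c', d', e', k', by simp; grind, rfl⟩
      · refine ⟨e', d', c', b', by simp; grind, ?_⟩
        ext z
        simp only [Finset.mem_insert, Finset.mem_singleton]
        grind [Sym2.eq_swap]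

theorem face_two (hF : IsFullerene G faces) {f : Finset (Sym2 V)} (hf : f ∈ faces) {v x y z : V}
    (hx : s(v, x) ∈ f) (hy : s(v, y) ∈ f) (hxy : x ≠ y) (hz : s(v, z) ∈ f) : z = x ∨ z = y := by
  rcases hF.face_cyclic hf hx with ⟨-, c, d, e, hn, rfl⟩ | ⟨-, c, d, e, k, hn, rfl⟩ <;>
  · simp only [Finset.mem_insert, Finset.mem_singleton, Sym2.eq_iff, List.nodup_cons,
      List.mem_cons, List.not_mem_nil, or_false, not_or] at hn hy hz
    grind

theorem face_other (hF : IsFullerene G faces) {f : Finset (Sym2 V)} (hf : f ∈ faces) {u v : V}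
    (h : s(u, v) ∈ f) : ∃ w, w ≠ u ∧ s(v, w) ∈ f := by
  rcases hF.face_cyclic hf h with ⟨-, c, d, e, hn, rfl⟩ | ⟨-, c, d, e, k, hn, rfl⟩ <;>
  · refine ⟨c, ?_, by simp⟩
    simp only [List.nodup_cons, List.mem_cons, List.not_mem_nil, or_false, not_or] at hn
    grind

theorem adj_eq (hF : IsFullerene G faces) {v x y z u : V} (hx : G.Adj v x) (hy : G.Adj v y)
    (hz : G.Adj v z) (hxy : x ≠ y) (hxz : x ≠ z) (hyz : y ≠ z) (hu : G.Adj v u) :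
    u = x ∨ u = y ∨ u = z := by
  have h3 : ({x, y, z} : Set V).ncard = 3 := Set.ncard_eq_three.2 ⟨x, y, z, hxy, hxz, hyz, rfl⟩
  have hs : ({x, y, z} : Set V) ⊆ G.neighborSet v := by
    rintro w (rfl | rfl | rfl) <;> assumption
  have he := Set.eq_of_subset_of_ncard_le hs (by rw [h3, hF.cubic])
  have : u ∈ ({x, y, z} : Set V) := he ▸ hu
  simpa using this

theorem exists_third (hF : IsFullerene G faces) (v x y : V) :
    ∃ w, G.Adj v w ∧ w ≠ x ∧ w ≠ y := by
  by_contra! h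
  have hs : G.neighborSet v ⊆ {x, y} := fun w hw => by
    by_cases hx : w = x
    · simp [hx]
    · simp [h w hw hx]
  have h1 := Set.ncard_le_ncard hs
  have h2 := Set.ncard_insert_le x {y}
  rw [hF.cubic] at h1
  rw [Set.ncard_singleton] at h2
  omega

theorem edge_faces (hF : IsFullerene G faces) {e : Sym2 V} {f g h : Finset (Sym2 V)}
    (hf : f ∈ faces) (hg : g ∈ faces) (hh : h ∈ faces) (ef : e ∈ f) (eg : e ∈ g) (eh : e ∈ h)
    (hfg : f ≠ g) (hfh : f ≠ h) : g = h := by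
  by_contra hgh
  have he : e ∈ G.edgeSet := by
    induction e with | _ u v => exact hF.face_adj hf ef
  have h2 := hF.edge_two_faces e he
  have hs : ({f, g, h} : Finset (Finset (Sym2 V))) ⊆ faces.filter (fun f => e ∈ f) := by
    intro k hk
    simp only [Finset.mem_insert, Finset.mem_singleton] at hk
    rcases hk with rfl | rfl | rfl <;> simp [*]
  have := Finset.card_le_card hs
  rw [Finset.card_eq_three.2 ⟨f, g, h, hfg, hfh, hgh, rfl⟩] at this
  omega

theorem exists_two_faces (hF : IsFullerene G faces) {u v : V} (h : G.Adj u v) :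
    ∃ f ∈ faces, ∃ g ∈ faces, f ≠ g ∧ s(u, v) ∈ f ∧ s(u, v) ∈ g := by
  obtain ⟨f, g, hfg, hE⟩ := Finset.card_eq_two.1 (hF.edge_two_faces s(u, v) h)
  have hf : f ∈ faces.filter (fun f => s(u, v) ∈ f) := by simp [hE]
  have hg : g ∈ faces.filter (fun f => s(u, v) ∈ f) := by simp [hE]
  rw [Finset.mem_filter] at hf hg
  exact ⟨f, hf.1, g, hg.1, hfg, hf.2, hg.2⟩

theorem corner_unique (hF : IsFullerene G faces) {f g : Finset (Sym2 V)} (hf : f ∈ faces)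
    (hg : g ∈ faces) {u v w : V} (huw : u ≠ w) (fu : s(v, u) ∈ f) (fw : s(v, w) ∈ f)
    (gu : s(v, u) ∈ g) (gw : s(v, w) ∈ g) : f = g := by
  by_contra hfg
  obtain ⟨x, hx, hxu, hxw⟩ := hF.exists_third v u w
  obtain ⟨k, hk, -, -, -, kx, -⟩ := hF.exists_two_faces hx.symm
  obtain ⟨z, hzx, kz⟩ := hF.face_other hk kx
  have hkf : f ≠ k := by
    rintro rfl
    rw [Sym2.eq_swap] at kx
    rcases hF.face_two hf fu fw huw kx with h | h <;> contradiction
  have hkg : g ≠ k := by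
    rintro rfl
    rw [Sym2.eq_swap] at kx
    rcases hF.face_two hg gu gw huw kx with h | h <;> contradiction
  rcases hF.adj_eq (hF.face_adj hf fu) (hF.face_adj hf fw) hx huw hxu.symm hxw.symm
    (hF.face_adj hk kz) with rfl | rfl | rfl
  · exact hkg (hF.edge_faces hf hg hk fu gu kz hfg hkf)
  · exact hkg (hF.edge_faces hf hg hk fw gw kz hfg hkf)
  · exact hzx rfl

theorem third_edge (hF : IsFullerene G faces) {f g : Finset (Sym2 V)} (hf : f ∈ faces)
    (hg : g ∈ faces) (hfg : f ≠ g) {u v x y : V} (fu : s(v, u) ∈ f) (gu : s(v, u) ∈ g)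
    (fx : s(v, x) ∈ f) (hxu : x ≠ u) (hy : G.Adj v y) (hyu : y ≠ u) (hyx : y ≠ x) :
    s(v, y) ∈ g := by
  obtain ⟨z, hzu, gz⟩ := hF.face_other hg (Sym2.eq_swap (a := u) (b := v) ▸ gu)
  rcases hF.adj_eq (hF.face_adj hf fu) (hF.face_adj hf fx) hy hxu.symm hyu.symm hyx.symm
    (hF.face_adj hg gz) with rfl | rfl | rfl
  · exact absurd rfl hzu
  · exact absurd (hF.corner_unique hf hg hxu.symm fu fx gu gz) hfg
  · exact gz

theorem corner_exists (hF : IsFullerene G faces) {u v w : V} (hu : G.Adj v u) (hw : G.Adj v w)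
    (huw : u ≠ w) : ∃ f ∈ faces, s(v, u) ∈ f ∧ s(v, w) ∈ f := by
  obtain ⟨f, hf, g, hg, hfg, fu, gu⟩ := hF.exists_two_faces hu
  obtain ⟨x, hxu, fx⟩ := hF.face_other hf (Sym2.eq_swap (a := u) (b := v) ▸ fu)
  by_cases hxw : x = w
  · exact ⟨f, hf, fu, hxw ▸ fx⟩
  · exact ⟨g, hg, gu, hF.third_edge hf hg hfg fu gu fx hxu hw huw.symm (Ne.symm hxw)⟩

/-- Two faces through an edge `vu` which turn differently at `v` are different. -/
theorem face_ne (hF : IsFullerene G faces) {f g : Finset (Sym2 V)} (hf : f ∈ faces)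
    {u v x y : V} (fu : s(v, u) ∈ f) (fx : s(v, x) ∈ f) (hux : u ≠ x)
    (gy : s(v, y) ∈ g) (hyu : y ≠ u) (hyx : y ≠ x) : f ≠ g := by
  rintro rfl
  rcases hF.face_two hf fu fx hux gy with h | h <;> contradiction

/-- A pentagonal face is determined by any path on five vertices in its boundary. -/
theorem face_path_five (hF : IsFullerene G faces) {f : Finset (Sym2 V)} (hf : f ∈ faces)
    {a b c d e : V} (hn : [a, b, c, d, e].Nodup) (h1 : s(a, b) ∈ f) (h2 : s(b, c) ∈ f)
    (h3 : s(c, d) ∈ f) (h4 : s(d, e) ∈ f) :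
    (f.card = 5 ∧ s(e, a) ∈ f) ∨
    (f.card = 6 ∧ ∃ k, s(e, k) ∈ f ∧ s(k, a) ∈ f ∧
      ∀ x ∈ faceVerts f, x = a ∨ x = b ∨ x = c ∨ x = d ∨ x = e ∨ x = k) := by
  simp only [List.nodup_cons, List.mem_cons, List.not_mem_nil, or_false, not_or] at hn
  rcases hF.face_cyclic hf h1 with ⟨h5, c', d', e', hn', rfl⟩ | ⟨h5, c', d', e', k', hn', rfl⟩
  · refine Or.inl ⟨h5, ?_⟩
    simp only [List.nodup_cons, List.mem_cons, List.not_mem_nil, or_false, not_or, Sym2.eq_iff,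
      Finset.mem_insert, Finset.mem_singleton] at *
    grind
  · refine Or.inr ⟨h5, k', ?_⟩
    simp only [List.nodup_cons, List.mem_cons, List.not_mem_nil, or_false, not_or, Sym2.eq_iff,
      Finset.mem_insert, Finset.mem_singleton, faceVerts, Set.mem_ofPred_eq] at *
    obtain rfl : c = c' := by grind
    obtain rfl : d = d' := by grind
    obtain rfl : e = e' := by grind
    refine ⟨by grind, by grind, ?_⟩
    rintro x ⟨e, he, hx⟩
    rcases he with rfl | rfl | rfl | rfl | rfl | rfl <;> simp only [Sym2.mem_iff] at hx <;> grind

theorem face_path_next (hF : IsFullerene G faces) {f : Finset (Sym2 V)} (hf : f ∈ faces)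
    {a b c d e k : V} (hn : [a, b, c, d, e].Nodup) (h1 : s(a, b) ∈ f) (h2 : s(b, c) ∈ f)
    (h3 : s(c, d) ∈ f) (h4 : s(d, e) ∈ f) (h5 : s(e, k) ∈ f) (hk : k ≠ d) :
    k = a ∨ s(k, a) ∈ f := by
  by_cases hka : k = a
  · exact Or.inl hka
  right
  have h4' : s(e, d) ∈ f := Sym2.eq_swap (a := d) (b := e) ▸ h4
  rcases hF.face_path_five hf hn h1 h2 h3 h4 with ⟨-, h⟩ | ⟨-, k', hk', hka', -⟩
  · rcases hF.face_two hf h4' h5 hk.symm h <;> grind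
  · rcases hF.face_two hf h4' h5 hk.symm hk' with rfl | rfl
    · have h3' : s(k', c) ∈ f := Sym2.eq_swap (a := c) ▸ h3
      rcases hF.face_two hf h3' h4 (by grind) hka' <;> grind
    · exact hka'

theorem face_path_six (hF : IsFullerene G faces) {f : Finset (Sym2 V)} (hf : f ∈ faces)
    {a b c d e k : V} (hn : [a, b, c, d, e, k].Nodup) (h1 : s(a, b) ∈ f) (h2 : s(b, c) ∈ f)
    (h3 : s(c, d) ∈ f) (h4 : s(d, e) ∈ f) (h5 : s(e, k) ∈ f) : s(k, a) ∈ f := by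
  simp only [List.nodup_cons, List.mem_cons, List.not_mem_nil, or_false, not_or] at hn
  exact (hF.face_path_next hf (by simp; grind) h1 h2 h3 h4 h5 (by grind)).resolve_left (by grind)

theorem face_path_seven (hF : IsFullerene G faces) {f : Finset (Sym2 V)} (hf : f ∈ faces)
    {a b c d e k l : V} (hn : [a, b, c, d, e, k, l].Nodup) (h1 : s(a, b) ∈ f)
    (h2 : s(b, c) ∈ f) (h3 : s(c, d) ∈ f) (h4 : s(d, e) ∈ f) (h5 : s(e, k) ∈ f)
    (h6 : s(k, l) ∈ f) : False := by
  simp only [List.nodup_cons, List.mem_cons, List.not_mem_nil, or_false, not_or] at hn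
  have h := hF.face_path_six hf (a := a) (b := b) (c := c) (d := d) (e := e) (k := k)
    (by simp; grind) h1 h2 h3 h4 h5
  have h5' : s(k, e) ∈ f := Sym2.eq_swap (a := e) ▸ h5
  rcases hF.face_two hf h5' h6 (by grind) h <;> grind

end Local

end IsFullerene

namespace IsFullerene

section Cut

variable {V : Type*} [Fintype V] [DecidableEq V] {G : SimpleGraph V}
  {faces : Finset (Finset (Sym2 V))}

theorem connected (hF : IsFullerene G faces) : G.Connected := by
  have h := hF.threeConnected ∅ (by simp)
  rw [Set.compl_empty] at h
  exact (SimpleGraph.induceUnivIso G).connected_iff.1 h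

theorem eq_of_forall_adj (hF : IsFullerene G faces) {α : Type*} (χ : V → α)
    (h : ∀ u v, G.Adj u v → χ u = χ v) (u v : V) : χ u = χ v := by
  obtain ⟨p⟩ := hF.connected u v
  induction p with
  | nil => rfl
  | cons hadj _ ih => exact (h _ _ hadj).trans ih

theorem face_nonempty (hF : IsFullerene G faces) {f : Finset (Sym2 V)} (hf : f ∈ faces) :
    ∃ u v, s(u, v) ∈ f := by
  have : f.Nonempty := by
    rw [← Finset.card_pos]
    have := hF.face_size f hf
    omega
  obtain ⟨e, he⟩ := this
  induction e with | _ u v => exact ⟨u, v, he⟩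

/-- The dual graph is connected. -/
theorem eq_of_forall_share (hF : IsFullerene G faces) {α : Type*} (ψ : Finset (Sym2 V) → α)
    (h : ∀ f ∈ faces, ∀ g ∈ faces, ∀ e ∈ f, e ∈ g → ψ f = ψ g)
    {f g : Finset (Sym2 V)} (hf : f ∈ faces) (hg : g ∈ faces) : ψ f = ψ g := by
  have key : ∀ v, ∃ c, ∀ k ∈ faces, ∀ x, s(v, x) ∈ k → ψ k = c := by
    intro v
    obtain ⟨x, hx, -, -⟩ := hF.exists_third v v v
    obtain ⟨y, hy, hyx, -⟩ := hF.exists_third v x x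
    obtain ⟨k₀, hk₀, kx, ky⟩ := hF.corner_exists hx hy hyx.symm
    refine ⟨ψ k₀, fun k hk z kz => ?_⟩
    by_cases hzx : z = x
    · exact h k hk k₀ hk₀ _ kz (hzx ▸ kx)
    · obtain ⟨k₁, hk₁, k₁z, k₁x⟩ := hF.corner_exists (hF.face_adj hk kz) hx hzx
      exact (h k hk k₁ hk₁ _ kz k₁z).trans (h k₁ hk₁ k₀ hk₀ _ k₁x kx)
  choose c hc using key
  have hcc : ∀ u v, c u = c v := hF.eq_of_forall_adj c fun u v huv => by
    obtain ⟨k, hk, -, -, -, ke, -⟩ := hF.exists_two_faces huv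
    rw [← hc u k hk v ke, ← hc v k hk u (Sym2.eq_swap (a := u) ▸ ke)]
  obtain ⟨u, x, hu⟩ := hF.face_nonempty hf
  obtain ⟨v, y, hv⟩ := hF.face_nonempty hg
  rw [hc u f hf x hu, hc v g hg y hv, hcc u v]

/-- The vertex-edge incidence matrix over `ZMod 2`. -/
def edgeVertex (G : SimpleGraph V) : Matrix G.edgeSet V (ZMod 2) :=
  fun e v => if v ∈ (e : Sym2 V) then 1 else 0

/-- The face-edge incidence matrix over `ZMod 2`. -/
def faceEdge (G : SimpleGraph V) (faces : Finset (Finset (Sym2 V))) :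
    Matrix faces G.edgeSet (ZMod 2) :=
  fun f e => if (e : Sym2 V) ∈ (f : Finset (Sym2 V)) then 1 else 0

theorem edgeVertex_mulVec (χ : V → ZMod 2) {u v : V} (h : G.Adj u v) :
    (edgeVertex G).mulVec χ ⟨s(u, v), h⟩ = χ u + χ v := by
  have : ∀ w, (if w = u ∨ w = v then (1 : ZMod 2) else 0) * χ w =
      (if w = u then χ w else 0) + (if w = v then χ w else 0) := by
    intro w
    have := h.ne
    by_cases h1 : w = u <;> by_cases h2 : w = v <;> simp_all
  simp [Matrix.mulVec, dotProduct, edgeVertex, this, Finset.sum_add_distrib]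

open Classical in
theorem faceEdge_mul_edgeVertex (hF : IsFullerene G faces) :
    faceEdge G faces * edgeVertex G = 0 := by
  ext ⟨f, hf⟩ v
  have hsum : (faceEdge G faces * edgeVertex G) ⟨f, hf⟩ v =
      ((Finset.univ.filter fun e : G.edgeSet => v ∈ (e : Sym2 V) ∧ (e : Sym2 V) ∈ f).card
        : ZMod 2) := by
    simp [Matrix.mul_apply, faceEdge, edgeVertex, ← ite_and]
  rw [hsum]
  by_cases hv : ∃ x, s(x, v) ∈ f
  · obtain ⟨x, hx⟩ := hv
    obtain ⟨y, hyx, hy⟩ := hF.face_other hf hx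
    rw [Sym2.eq_swap] at hx
    have : (Finset.univ.filter fun e : G.edgeSet => v ∈ (e : Sym2 V) ∧ (e : Sym2 V) ∈ f) =
        {⟨s(v, x), hF.face_adj hf hx⟩, ⟨s(v, y), hF.face_adj hf hy⟩} := by
      ext ⟨e, he⟩
      simp only [Finset.mem_filter, Finset.mem_univ, true_and, Finset.mem_insert,
        Finset.mem_singleton, Subtype.ext_iff]
      constructor
      · rintro ⟨⟨z, rfl⟩, hef⟩
        rcases hF.face_two hf hx hy hyx.symm hef with rfl | rfl <;> simp
      · rintro (rfl | rfl) <;> simp [hx, hy]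
    rw [this, Finset.card_pair (by
      simp only [ne_eq, Subtype.ext_iff, Sym2.eq_iff]; grind)]
    rfl
  · have : (Finset.univ.filter fun e : G.edgeSet =>
        v ∈ (e : Sym2 V) ∧ (e : Sym2 V) ∈ f) = ∅ := by
      ext ⟨e, he⟩
      simp only [Finset.mem_filter, Finset.mem_univ, true_and, Finset.notMem_empty, iff_false,
        not_and]
      rintro ⟨z, rfl⟩ hef
      exact hv ⟨z, Sym2.eq_swap (a := v) ▸ hef⟩
    rw [this]
    simp

open Classical in
theorem finrank_ker_edgeVertex (hF : IsFullerene G faces) :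
    Module.finrank (ZMod 2) (LinearMap.ker (edgeVertex G).mulVecLin) ≤ 1 := by
  refine finrank_le_one ⟨fun _ => 1, ?_⟩ ?_
  · rw [LinearMap.mem_ker]
    ext ⟨e, he⟩
    induction e with | _ u v =>
    rw [Matrix.mulVecLin_apply, edgeVertex_mulVec _ he]
    rfl
  · rintro ⟨χ, hχ⟩
    obtain ⟨v₀⟩ := hF.connected.nonempty
    refine ⟨χ v₀, Subtype.ext ?_⟩
    funext v
    have := hF.eq_of_forall_adj χ (fun x y hxy => by
      have h0 := congrFun (LinearMap.mem_ker.1 hχ) ⟨s(x, y), hxy⟩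
      rw [Matrix.mulVecLin_apply, edgeVertex_mulVec _ hxy] at h0
      exact CharTwo.add_eq_zero.1 h0) v₀ v
    simpa using this

open Classical in
theorem finrank_ker_faceEdge_transpose (hF : IsFullerene G faces) :
    Module.finrank (ZMod 2) (LinearMap.ker (faceEdge G faces).transpose.mulVecLin) ≤ 1 := by
  have key : ∀ (ψ : faces → ZMod 2) (e : Sym2 V) (he : e ∈ G.edgeSet) (f g : faces), f ≠ g →
      e ∈ f.1 → e ∈ g.1 → (faceEdge G faces).transpose.mulVec ψ ⟨e, he⟩ = ψ f + ψ g := by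
    intro ψ e he f g hfg hef heg
    have : ∀ k : faces, (if e ∈ k.1 then (1 : ZMod 2) else 0) * ψ k =
        (if k = f then ψ k else 0) + (if k = g then ψ k else 0) := by
      intro k
      by_cases h1 : k = f
      · subst h1; simp [hef, hfg]
      by_cases h2 : k = g
      · subst h2; simp [heg, h1]
      rw [if_neg, if_neg h1, if_neg h2]
      · simp
      · intro hek
        exact h2 (Subtype.ext (hF.edge_faces f.2 g.2 k.2 hef heg hek
          (fun h => hfg (Subtype.ext h)) (fun h => h1 (Subtype.ext h.symm)))).symm
    simp [Matrix.mulVec, dotProduct, faceEdge, this, Finset.sum_add_distrib, -Finset.univ_eq_attach]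
  refine finrank_le_one ⟨fun _ => 1, ?_⟩ ?_
  · rw [LinearMap.mem_ker]
    ext ⟨e, he⟩
    induction e with | _ u v =>
    obtain ⟨f, hf, g, hg, hfg, ef, eg⟩ := hF.exists_two_faces he
    rw [Matrix.mulVecLin_apply, key _ _ he ⟨f, hf⟩ ⟨g, hg⟩ (by simpa using hfg) ef eg]
    rfl
  · rintro ⟨ψ, hψ⟩
    obtain ⟨v₀⟩ := hF.connected.nonempty
    obtain ⟨x, hx, -, -⟩ := hF.exists_third v₀ v₀ v₀
    obtain ⟨f₀, hf₀, -⟩ := hF.exists_two_faces hx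
    refine ⟨ψ ⟨f₀, hf₀⟩, Subtype.ext ?_⟩
    funext ⟨f, hf⟩
    have := hF.eq_of_forall_share (fun k => if hk : k ∈ faces then ψ ⟨k, hk⟩ else 0)
      (fun k hk l hl e ek el => by
        by_cases hkl : k = l
        · rw [hkl]
        have he : e ∈ G.edgeSet := by
          induction e with | _ u v => exact hF.face_adj hk ek
        have h0 := congrFun (LinearMap.mem_ker.1 hψ) ⟨e, he⟩
        rw [Matrix.mulVecLin_apply, key _ _ he ⟨k, hk⟩ ⟨l, hl⟩ (by simpa using hkl) ek el] at h0
        simpa [hk, hl] using CharTwo.add_eq_zero.1 h0) hf₀ hf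
    simpa [hf₀, hf] using this

open Classical in
/-- Every set of edges meeting each face in an even number of edges is an edge cut. -/
theorem exists_cut (hF : IsFullerene G faces) (D : Finset (Sym2 V))
    (hD : ∀ f ∈ faces, Even (D ∩ f).card) :
    ∃ χ : V → ZMod 2, ∀ u v, G.Adj u v → (s(u, v) ∈ D ↔ χ u ≠ χ v) := by
  set B := (edgeVertex G).mulVecLin with hB
  set C := (faceEdge G faces).mulVecLin with hC
  have hle : LinearMap.range B ≤ LinearMap.ker C := by
    rintro _ ⟨χ, rfl⟩
    rw [LinearMap.mem_ker, hB, hC, Matrix.mulVecLin_apply, Matrix.mulVecLin_apply,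
      Matrix.mulVec_mulVec, faceEdge_mul_edgeVertex hF, Matrix.zero_mulVec]
  have rB := B.finrank_range_add_finrank_ker
  have rC := C.finrank_range_add_finrank_ker
  have rT := (faceEdge G faces).transpose.mulVecLin.finrank_range_add_finrank_ker
  have hrank : Module.finrank (ZMod 2) (LinearMap.range C) =
      Module.finrank (ZMod 2) (LinearMap.range (faceEdge G faces).transpose.mulVecLin) :=
    (Matrix.rank_transpose (faceEdge G faces)).symm
  have kB : Module.finrank (ZMod 2) (LinearMap.ker B) ≤ 1 := finrank_ker_edgeVertex hF
  have kT := finrank_ker_faceEdge_transpose hF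
  have heul := hF.euler
  rw [← Nat.card_coe_set_eq, Nat.card_eq_fintype_card] at heul
  simp only [Module.finrank_fintype_fun_eq_card, Fintype.card_coe] at rB rC rT
  have heq : LinearMap.range B = LinearMap.ker C :=
    Submodule.eq_of_le_of_finrank_le hle (by omega)
  have hmem : (fun e : G.edgeSet => if (e : Sym2 V) ∈ D then (1 : ZMod 2) else 0) ∈
      LinearMap.ker C := by
    rw [LinearMap.mem_ker]
    ext ⟨f, hf⟩
    have hcard : (Finset.univ.filter fun e : G.edgeSet =>
        (e : Sym2 V) ∈ D ∧ (e : Sym2 V) ∈ f).card = (D ∩ f).card := by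
      refine Finset.card_bij (fun e _ => (e : Sym2 V)) ?_ ?_ ?_
      · intro e he
        simp only [Finset.mem_filter, Finset.mem_univ, true_and] at he
        simp [he]
      · intro e _ e' _ h
        exact Subtype.ext h
      · intro e he
        rw [Finset.mem_inter] at he
        refine ⟨⟨e, ?_⟩, by simp [he], rfl⟩
        induction e with | _ u v => exact hF.face_adj hf he.2
    have : C (fun e : G.edgeSet => if (e : Sym2 V) ∈ D then (1 : ZMod 2) else 0) ⟨f, hf⟩ =
        ((D ∩ f).card : ZMod 2) := by
      rw [← hcard]
      simp [hC, Matrix.mulVec, dotProduct, faceEdge, ← ite_and]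
    rw [this, Pi.zero_apply]
    exact (ZMod.natCast_eq_zero_iff_even).2 (hD f hf)
  rw [← heq] at hmem
  obtain ⟨χ, hχ⟩ := hmem
  refine ⟨χ, fun u v huv => ?_⟩
  have h1 := congrFun hχ ⟨s(u, v), huv⟩
  rw [hB, Matrix.mulVecLin_apply, edgeVertex_mulVec _ huv] at h1
  rw [Ne, ← CharTwo.add_eq_zero, h1]
  simp

end Cut

end IsFullerene

/-- One side of a ring of eleven pentagons. The ring edges end in the vertices `a i`, in cyclic
order. If `t i` is `false` then `a i` and `a (i + 1)` are adjacent; otherwise they are joined by a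
path through a vertex `p i`, whose third neighbour is `w i`. The face `g i` is the face at `a i`
that does not belong to the ring. All these vertices lie in `S`. -/
structure RingSide {V : Type*} (faces : Finset (Finset (Sym2 V))) (S : Set V)
    (t : ZMod 11 → Bool) (a p w : ZMod 11 → V) (g : ZMod 11 → Finset (Sym2 V)) : Prop where
  g_mem : ∀ i, g i ∈ faces
  a_inj : Function.Injective a
  a_ne_p : ∀ i j, t j = true → a i ≠ p j
  p_inj : ∀ i j, t i = true → t j = true → p i = p j → i = j
  a_ne_w : ∀ i j, t j = true → a i ≠ w j
  a_mem : ∀ i, a i ∈ S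
  p_mem : ∀ i, t i = true → p i ∈ S
  w_mem : ∀ i, t i = true → w i ∈ S
  edge : ∀ i j, j = i + 1 → t i = false → s(a i, a j) ∈ g i
  g_eq : ∀ i j, j = i + 1 → t i = false → g j = g i
  ap : ∀ i, t i = true → s(a i, p i) ∈ g i
  pw : ∀ i, t i = true → s(p i, w i) ∈ g i
  pw_next : ∀ i j, j = i + 1 → t i = true → s(p i, w i) ∈ g j
  pa : ∀ i j, j = i + 1 → t i = true → s(p i, a j) ∈ g j

/-- Two vertices `p i` and `p j` are joined by a chord with the same face behind both. -/
structure RingSide.Chord {V : Type*} (t : ZMod 11 → Bool) (p w : ZMod 11 → V)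
    (g : ZMod 11 → Finset (Sym2 V)) (i j : ZMod 11) : Prop where
  left : t i = true
  right : t j = true
  w_left : w i = p j
  w_right : w j = p i
  g_eq : g i = g (j + 1)

namespace RingSide

theorem ne_succ : ∀ i : ZMod 11, i ≠ i + 1 := by decide

section

variable {V : Type*} {faces : Finset (Finset (Sym2 V))} {S : Set V}
  {t : ZMod 11 → Bool} {a p w : ZMod 11 → V} {g : ZMod 11 → Finset (Sym2 V)}

theorem shift (R : RingSide faces S t a p w g) (k : ZMod 11) :
    RingSide faces S (fun i => t (i + k)) (fun i => a (i + k)) (fun i => p (i + k))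
      (fun i => w (i + k)) (fun i => g (i + k)) where
  g_mem i := R.g_mem _
  a_inj i j h := add_right_cancel (R.a_inj h)
  a_ne_p i j h := R.a_ne_p _ _ h
  p_inj i j hi hj h := add_right_cancel (R.p_inj _ _ hi hj h)
  a_ne_w i j h := R.a_ne_w _ _ h
  a_mem i := R.a_mem _
  p_mem i := R.p_mem _
  w_mem i := R.w_mem _
  edge i j h := R.edge _ _ (by rw [h]; ring)
  g_eq i j h := R.g_eq _ _ (by rw [h]; ring)
  ap i := R.ap _
  pw i := R.pw _
  pw_next i j h := R.pw_next _ _ (by rw [h]; ring)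
  pa i j h := R.pa _ _ (by rw [h]; ring)

theorem card_shift (t : ZMod 11 → Bool) (k : ZMod 11) :
    (Finset.univ.filter fun i => t (i + k) = true).card =
      (Finset.univ.filter fun i => t i = true).card :=
  Finset.card_equiv (Equiv.addRight k) (by simp)

theorem card_ge_six {t : ZMod 11 → Bool} (l : List (ZMod 11)) (hl : l.Nodup)
    (h6 : l.length = 6) (h : ∀ i ∈ l, t i = true) :
    6 ≤ (Finset.univ.filter fun i => t i = true).card := by
  rw [← h6, ← List.toFinset_card_of_nodup hl]
  exact Finset.card_le_card fun i hi => by simpa using h i (by simpa using hi)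

theorem exists_prev (R : RingSide faces S t a p w g) {i j : ZMod 11} (hj : j = i + 1) :
    ∃ x, s(x, a j) ∈ g j ∧ ((t i = true ∧ x = p i) ∨ (t i = false ∧ x = a i)) := by
  cases h : t i
  · exact ⟨a i, R.g_eq i j hj h ▸ R.edge i j hj h, by simp⟩
  · exact ⟨p i, R.pa i j hj h, by simp⟩

theorem exists_next (R : RingSide faces S t a p w g) {i j : ZMod 11} (hj : j = i + 1) :
    ∃ x, s(a i, x) ∈ g i ∧ ((t i = true ∧ x = p i) ∨ (t i = false ∧ x = a j)) := by
  cases h : t i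
  · exact ⟨a j, R.edge i j hj h, by simp⟩
  · exact ⟨p i, R.ap i h, by simp⟩

theorem a_ne (R : RingSide faces S t a p w g) {i j : ZMod 11} (h : i ≠ j) : a i ≠ a j :=
  R.a_inj.ne h

theorem p_ne (R : RingSide faces S t a p w g) {i j : ZMod 11} (hi : t i = true)
    (hj : t j = true) (h : i ≠ j) : p i ≠ p j :=
  fun he => h (R.p_inj i j hi hj he)

end

variable {V : Type*} [Fintype V] [DecidableEq V] {G : SimpleGraph V}
  {faces : Finset (Finset (Sym2 V))} {S : Set V}
  {t : ZMod 11 → Bool} {a p w : ZMod 11 → V} {g : ZMod 11 → Finset (Sym2 V)}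

theorem g_ne (R : RingSide faces S t a p w g) (hF : IsFullerene G faces) {i j : ZMod 11}
    (hj : j = i + 1) (hi : t i = true) : g i ≠ g j :=
  hF.face_ne (R.g_mem i) (Sym2.eq_swap (a := a i) ▸ R.ap i hi) (R.pw i hi)
    (R.a_ne_w _ _ hi) (R.pa i j hj hi)
    (R.a_ne (hj ▸ (ne_succ i).symm)) (R.a_ne_w _ _ hi)

theorem w_ne_p (R : RingSide faces S t a p w g) (hF : IsFullerene G faces) {i k : ZMod 11}
    (hi : t i = true) (hk : t k = true) (hik : i ≠ k) (hw : w i = w k) (j : ZMod 11)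
    (hj : t j = true) : w i ≠ p j := by
  intro h
  have h1 := hF.face_adj (R.g_mem i) (R.pw i hi)
  have h2 := hF.face_adj (R.g_mem k) (R.pw k hk)
  rw [← hw] at h2
  rw [h] at h1 h2
  have hn := R.a_ne (ne_succ j)
  have hx u := hF.adj_eq (u := u) (hF.face_adj (R.g_mem j) (R.ap j hj)).symm
    (hF.face_adj (R.g_mem (j + 1)) (R.pa j _ rfl hj)) (hF.face_adj (R.g_mem j) (R.pw j hj))
    hn (R.a_ne_w _ _ hj) (R.a_ne_w _ _ hj)
  have hpi := hx _ h1.symm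
  have hpk := hx _ h2.symm
  have := R.a_ne_p j i hi
  have := R.a_ne_p (j + 1) i hi
  have := R.a_ne_p j k hk
  have := R.a_ne_p (j + 1) k hk
  have := R.p_ne hi hk hik
  grind

theorem chord_of_mem (R : RingSide faces S t a p w g) (hF : IsFullerene G faces) {i j k : ZMod 11}
    (hk : k = i + 1) (hi : t i = true) (hj : t j = true) (hg : g k = g j)
    (h : s(p i, p j) ∈ g j) : Chord t p w g i j := by
  have h' : s(p j, p i) ∈ g j := Sym2.eq_swap (a := p i) ▸ h
  have hwi : w i = p j := by
    have hap := R.a_ne_p k j hj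
    have haw := R.a_ne_w k i hi
    have h1 := R.pa i k hk hi
    have h2 := R.pw_next i k hk hi
    rw [hg] at h1 h2
    rcases hF.face_two (R.g_mem j) h1 h hap h2 <;> grind
  have hwj : w j = p i := by
    have hap := R.a_ne_p j i hi
    have haw := R.a_ne_w j j hj
    have h1 := R.ap j hj
    rw [Sym2.eq_swap] at h1
    rcases hF.face_two (R.g_mem j) h1 h' hap (R.pw j hj) <;> grind
  refine ⟨hi, hj, hwi, hwj, ?_⟩
  refine hF.edge_faces (R.g_mem j) (R.g_mem i) (R.g_mem (j + 1)) h (hwi ▸ R.pw i hi) ?_ ?_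
    (R.g_ne hF rfl hj)
  · have := R.pw_next j _ rfl hj
    rwa [hwj, Sym2.eq_swap] at this
  · rw [← hg]
    exact (R.g_ne hF hk hi).symm

theorem chord_step (R : RingSide faces S t a p w g) (hF : IsFullerene G faces)
    {h k i j l m n : ZMod 11} (c : Chord t p w g i j) (hk : k = h + 1) (hi : i = k + 1)
    (hl : l = j + 1) (hm : m = l + 1) (hn : n = m + 1) (hd : [h, k, i, j, l, m].Nodup)
    (hd' : [k, i, j, l, m, n].Nodup) :
    Chord t p w g k l := by
  obtain ⟨ti, tj, wi, wj, hg⟩ := c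
  rw [← hl] at hg
  obtain ⟨x, hx, hx'⟩ := R.exists_prev hi
  obtain ⟨y, hy, hy'⟩ := R.exists_next hm
  simp only [List.nodup_cons, List.mem_cons, List.not_mem_nil, or_false, not_or] at hd hd'
  have e1 := R.ap i ti
  have e2 := R.pw i ti
  have e3 := R.pa j l hl tj
  rw [wi] at e2
  rw [← hg] at e3 hy
  have hne : ∀ i j, i ≠ j → a i ≠ a j := fun _ _ h => R.a_ne h
  have hnp := R.p_inj
  have hap := R.a_ne_p
  have close : s(y, x) ∈ g i :=
    hF.face_path_six (R.g_mem i) (by simp; grind) hx e1 e2 e3 hy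
  have close' : s(x, y) ∈ g i := Sym2.eq_swap (a := y) ▸ close
  have tk : t k = true := by
    by_contra tk
    obtain ⟨z, hz, hz'⟩ := R.exists_prev hk
    have tk' : t k = false := by simpa using tk
    rw [← R.g_eq k i hi tk', Sym2.eq_swap] at hz
    have hxk : x = a k := by grind
    subst hxk
    rcases hF.face_two (R.g_mem i) hx hz (by grind) close' <;> grind
  have tl : t l = true := by
    by_contra tl
    obtain ⟨z, hz, hz'⟩ := R.exists_next hn
    have tl' : t l = false := by simpa using tl
    rw [R.g_eq l m hm tl', ← hg] at hz
    have hyl : y = a m := by grind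
    subst hyl
    rw [Sym2.eq_swap] at hy
    rcases hF.face_two (R.g_mem i) hy hz (by grind) close <;> grind
  have hxk : x = p k := by grind
  have hyl : y = p l := by grind
  subst hxk hyl
  exact R.chord_of_mem hF hi tk tl hg (hg ▸ close')

/-- If `w i = w k`, and the edge from this vertex to its third neighbour `m` lies on both faces
between `p i` and `p k`, then the face on the other side would be too long. -/
theorem false_of_vee (R : RingSide faces S t a p w g) (hF : IsFullerene G faces)
    {h i j k l n : ZMod 11} {m : V} (hi : i = h + 1) (hj : j = i + 1) (hl : l = k + 1)
    (hn : n = l + 1) (hd : [h, i, k, l, n].Nodup) (ti : t i = true) (tk : t k = true)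
    (hw : w i = w k) (mj : s(w i, m) ∈ g j) (mk : s(w i, m) ∈ g k) (hmi : m ≠ p i)
    (hmk : m ≠ p k) : False := by
  simp only [List.nodup_cons, List.mem_cons, List.not_mem_nil, or_false, not_or] at hd
  have hik : i ≠ k := by grind
  have hzp := R.w_ne_p hF ti tk hik hw
  have hpik := R.p_ne ti tk hik
  have e1 := R.pw i ti
  have e1' : s(w i, p i) ∈ g i := Sym2.eq_swap (a := p i) ▸ e1
  have e2 : s(w i, p i) ∈ g j := Sym2.eq_swap (a := p i) ▸ R.pw_next i j hj ti
  have e3 : s(w i, p k) ∈ g k := Sym2.eq_swap (a := p k) ▸ hw ▸ R.pw k tk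
  have e4 : s(w i, p k) ∈ g l := Sym2.eq_swap (a := p k) ▸ hw ▸ R.pw_next k l hl tk
  have e5 : s(w i, p k) ∈ g i := hF.third_edge (R.g_mem j) (R.g_mem i)
    (R.g_ne hF hj ti).symm e2 e1' mj hmi (hF.face_adj (R.g_mem k) e3) hpik.symm hmk.symm
  have hki : g k ≠ g i := hF.face_ne (R.g_mem k) e3 mk hmk.symm e1' hpik hmi.symm
  have hil : g i = g l := hF.edge_faces (R.g_mem k) (R.g_mem i) (R.g_mem l) e3 e5 e4 hki
    (R.g_ne hF hl tk)
  obtain ⟨x, hx, hx'⟩ := R.exists_prev hi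
  obtain ⟨y, hy, hy'⟩ := R.exists_next hn
  have e6 := R.pa k l hl tk
  rw [← hil] at hy e6
  have hne : ∀ i j, i ≠ j → a i ≠ a j := fun _ _ h => R.a_ne h
  have hnp := R.p_inj
  have hap := R.a_ne_p
  have haw := R.a_ne_w
  exact hF.face_path_seven (R.g_mem i) (by simp; grind) hx (R.ap i ti) e1 e5 e6 hy

theorem gap_three (R : RingSide faces S t a p w g) (hF : IsFullerene G faces)
    {i j k l : ZMod 11} (hj : j = i + 1) (hk : k = j + 1) (hl : l = k + 1)
    (hd : [i, j, k, l].Nodup) (ti : t i = true) (tj : t j = false) (tk : t k = false)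
    (tl : t l = true) :
    Chord t p w g i l ∨ ((g j).card = 6 ∧ w i = w l ∧ ∀ x ∈ faceVerts (g j),
      x = p i ∨ x = a j ∨ x = a k ∨ x = a l ∨ x = p l ∨ x = w l) := by
  simp only [List.nodup_cons, List.mem_cons, List.not_mem_nil, or_false, not_or] at hd
  have hne : ∀ i j, i ≠ j → a i ≠ a j := fun _ _ h => R.a_ne h
  have hnp := R.p_inj
  have hap := R.a_ne_p
  have haw := R.a_ne_w
  have g1 := R.g_eq j k hk tj
  have g2 := R.g_eq k l hl tk
  have e1 := R.pa i j hj ti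
  have e2 := R.edge j k hk tj
  have e3 := R.edge k l hl tk
  have e4 := R.ap l tl
  have e5 := R.pw l tl
  have e6 := R.pw_next i j hj ti
  rw [g2, g1] at e4 e5
  rw [g1] at e3
  rcases hF.face_path_five (R.g_mem j) (by simp; grind) e1 e2 e3 e4 with
    ⟨-, h⟩ | ⟨h6, z, hz, hz', hv⟩
  · left
    refine R.chord_of_mem hF hj ti tl (by rw [g2, g1]) ?_
    rw [g2, g1, Sym2.eq_swap]
    exact h
  · right
    have e4' : s(p l, a l) ∈ g j := Sym2.eq_swap (a := a l) ▸ e4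
    have hwl : z = w l := by
      have hza : z ≠ a l := by
        rintro rfl
        rw [Sym2.eq_swap] at e3
        rcases hF.face_two (R.g_mem j) e3 e4 (by grind) hz' <;> grind
      rcases hF.face_two (R.g_mem j) e4' e5 (by grind) hz <;> grind
    have hwi : z = w i := by
      rw [Sym2.eq_swap] at hz'
      rcases hF.face_two (R.g_mem j) e1 e6 (by grind) hz' <;> grind
    subst hwl
    exact ⟨h6, hwi.symm, hv⟩

end RingSide

namespace RingSide

variable {V : Type*} [Fintype V] [DecidableEq V] {G : SimpleGraph V}
  {faces : Finset (Finset (Sym2 V))} {S : Set V}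
  {t : ZMod 11 → Bool} {a p w : ZMod 11 → V} {g : ZMod 11 → Finset (Sym2 V)}

theorem not_four_false (R : RingSide faces S t a p w g) (hF : IsFullerene G faces)
    {h i j k l m n : ZMod 11} (hi : i = h + 1) (hj : j = i + 1) (hk : k = j + 1) (hl : l = k + 1)
    (hm : m = l + 1) (hn : n = m + 1) (hd : [h, i, j, k, l, m, n].Nodup) :
    ¬ (t i = false ∧ t j = false ∧ t k = false ∧ t l = false) := by
  rintro ⟨ti, tj, tk, tl⟩
  simp only [List.nodup_cons, List.mem_cons, List.not_mem_nil, or_false, not_or] at hd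
  have hne : ∀ i j, i ≠ j → a i ≠ a j := fun _ _ h => R.a_ne h
  have hnp := R.p_inj
  have hap := R.a_ne_p
  have g1 := R.g_eq i j hj ti
  have g2 := R.g_eq j k hk tj
  have g3 := R.g_eq k l hl tk
  have g4 := R.g_eq l m hm tl
  obtain ⟨x, hx, hx'⟩ := R.exists_prev hi
  obtain ⟨y, hy, hy'⟩ := R.exists_next hn
  have e1 := R.edge i j hj ti
  have e2 := R.edge j k hk tj
  have e3 := R.edge k l hl tk
  have e4 := R.edge l m hm tl
  rw [g4, g3, g2, g1] at hy
  rw [g3, g2, g1] at e4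
  rw [g2, g1] at e3
  rw [g1] at e2
  exact hF.face_path_seven (R.g_mem i) (by simp; grind (splits := 30)) hx e1 e2 e3 e4 hy

theorem not_gap_four (R : RingSide faces S t a p w g) (hF : IsFullerene G faces)
    (hc : (Finset.univ.filter fun i => t i = true).card ≤ 5) :
    ¬ (t 0 = true ∧ t 1 = false ∧ t 2 = false ∧ t 3 = false ∧ t 4 = true) := by
  rintro ⟨t0, t1, t2, t3, t4⟩
  have hn : [a 1, a 2, a 3, a 4].Nodup := List.Nodup.map R.a_inj (l := [1, 2, 3, 4]) (by decide)
  have hap := R.a_ne_p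
  have hp := R.p_ne t0 t4 (by decide)
  have g1 := R.g_eq 1 2 rfl t1
  have g2 := R.g_eq 2 3 rfl t2
  have g3 := R.g_eq 3 4 rfl t3
  have e0 := R.pa 0 1 rfl t0
  have e1 := R.edge 1 2 rfl t1
  have e2 := R.edge 2 3 rfl t2
  have e3 := R.edge 3 4 rfl t3
  have e4 := R.ap 4 t4
  rw [g3, g2, g1] at e4
  rw [g2, g1] at e3
  rw [g1] at e2
  have close := hF.face_path_six (R.g_mem 1) (by simp at hn ⊢; grind) e0 e1 e2 e3 e4
  have c : Chord t p w g 0 4 := R.chord_of_mem hF rfl t0 t4 (g3.trans (g2.trans g1)).symm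
    (by rw [g3, g2, g1, Sym2.eq_swap]; exact close)
  have c1 : Chord t p w g 10 5 :=
    R.chord_step hF (h := 9) (m := 6) (n := 7) c rfl rfl rfl rfl rfl (by decide) (by decide)
  have c2 : Chord t p w g 9 6 :=
    R.chord_step hF (h := 8) (m := 7) (n := 8) c1 rfl rfl rfl rfl rfl (by decide) (by decide)
  have := card_ge_six (t := t) [0, 4, 5, 6, 9, 10] (by decide) rfl
    (by simp [t0, t4, c1.left, c1.right, c2.left, c2.right])
  omega

theorem gap_three_zero (R : RingSide faces S t a p w g) (hF : IsFullerene G faces)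
    (hc : (Finset.univ.filter fun i => t i = true).card ≤ 5)
    (t0 : t 0 = true) (t1 : t 1 = false) (t2 : t 2 = false) (t3 : t 3 = true) :
    (g 1).card = 6 ∧ w 0 = w 3 ∧ ∀ x ∈ faceVerts (g 1),
      x = p 0 ∨ x = a 1 ∨ x = a 2 ∨ x = a 3 ∨ x = p 3 ∨ x = w 3 := by
  refine (R.gap_three hF (i := 0) (j := 1) (k := 2) (l := 3) rfl rfl rfl (by decide)
    t0 t1 t2 t3).resolve_left fun c => ?_
  have c1 : Chord t p w g 10 4 :=
    R.chord_step hF (h := 9) (m := 5) (n := 6) c rfl rfl rfl rfl rfl (by decide) (by decide)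
  have c2 : Chord t p w g 9 5 :=
    R.chord_step hF (h := 8) (m := 6) (n := 7) c1 rfl rfl rfl rfl rfl (by decide) (by decide)
  have := card_ge_six (t := t) [0, 3, 4, 5, 9, 10] (by decide) rfl
    (by simp [t0, t3, c1.left, c1.right, c2.left, c2.right])
  omega

theorem hexagon_of_gap_three (R : RingSide faces S t a p w g) (hF : IsFullerene G faces)
    (hc : (Finset.univ.filter fun i => t i = true).card ≤ 5) {i j k l : ZMod 11}
    (hj : j = i + 1) (hk : k = j + 1) (hl : l = k + 1)
    (ti : t i = true) (tj : t j = false) (tk : t k = false) (tl : t l = true) :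
    (g j).card = 6 ∧ w i = w l ∧ ∀ x ∈ faceVerts (g j),
      x = p i ∨ x = a j ∨ x = a k ∨ x = a l ∨ x = p l ∨ x = w l := by
  have h0 : 0 + i = i := zero_add i
  have h1 : 1 + i = j := by rw [hj]; ring
  have h2 : 2 + i = k := by rw [hk, hj]; ring
  have h3 : 3 + i = l := by rw [hl, hk, hj]; ring
  have := (R.shift i).gap_three_zero hF (by rw [card_shift]; exact hc)
  simp only [h0, h1, h2, h3] at this
  exact this ti tj tk tl

theorem not_two_gaps_three (R : RingSide faces S t a p w g) (hF : IsFullerene G faces)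
    (hc : (Finset.univ.filter fun i => t i = true).card ≤ 5) :
    ¬ (t 0 = true ∧ t 1 = false ∧ t 2 = false ∧ t 3 = true ∧ t 4 = false ∧ t 5 = false ∧
      t 6 = true) := by
  rintro ⟨t0, t1, t2, t3, t4, t5, t6⟩
  obtain ⟨-, h1, -⟩ := R.hexagon_of_gap_three hF hc (i := 0) (j := 1) rfl rfl rfl t0 t1 t2 t3
  obtain ⟨-, h2, -⟩ := R.hexagon_of_gap_three hF hc (i := 3) (j := 4) rfl rfl rfl t3 t4 t5 t6
  have g1 : g 3 = g 1 := (R.g_eq 2 3 rfl t2).trans (R.g_eq 1 2 rfl t1)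
  have g2 : g 6 = g 4 := (R.g_eq 5 6 rfl t5).trans (R.g_eq 4 5 rfl t4)
  refine R.false_of_vee hF (h := 10) (i := 0) (j := 1) (k := 6) (l := 7) (n := 8) (m := p 3)
    rfl rfl rfl rfl (by decide) t0 t6 (h1.trans h2) ?_ ?_ (R.p_ne t3 t0 (by decide))
    (R.p_ne t3 t6 (by decide))
  · rw [h1, ← g1, Sym2.eq_swap]
    exact R.pw 3 t3
  · rw [h1, g2, Sym2.eq_swap]
    exact R.pw_next 3 4 rfl t3

theorem not_gaps_three_two_three (R : RingSide faces S t a p w g) (hF : IsFullerene G faces)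
    (hc : (Finset.univ.filter fun i => t i = true).card ≤ 5) :
    ¬ (t 0 = true ∧ t 1 = false ∧ t 2 = false ∧ t 3 = true ∧ t 4 = false ∧ t 5 = true ∧
      t 6 = false ∧ t 7 = false ∧ t 8 = true) := by
  rintro ⟨t0, t1, t2, t3, t4, t5, t6, t7, t8⟩
  obtain ⟨-, h1, -⟩ := R.hexagon_of_gap_three hF hc (i := 0) (j := 1) rfl rfl rfl t0 t1 t2 t3
  obtain ⟨-, h2, -⟩ := R.hexagon_of_gap_three hF hc (i := 5) (j := 6) rfl rfl rfl t5 t6 t7 t8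
  have hm := R.w_ne_p hF t0 t3 (by decide) h1
  have hm' := R.w_ne_p hF t5 t8 (by decide) h2
  have p03 := R.p_ne t0 t3 (by decide)
  have p58 := R.p_ne t5 t8 (by decide)
  have p08 := R.p_ne t0 t8 (by decide)
  have p35 := R.p_ne t3 t5 (by decide)
  have p05 := R.p_ne t0 t5 (by decide)
  have p38 := R.p_ne t3 t8 (by decide)
  have g1 : g 3 = g 1 := (R.g_eq 2 3 rfl t2).trans (R.g_eq 1 2 rfl t1)
  have g4 : g 5 = g 4 := R.g_eq 4 5 rfl t4
  have g8 : g 8 = g 6 := (R.g_eq 7 8 rfl t7).trans (R.g_eq 6 7 rfl t6)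
  have e00 : s(w 0, p 0) ∈ g 0 := Sym2.eq_swap (a := p 0) ▸ R.pw 0 t0
  have e01 : s(w 0, p 0) ∈ g 1 := Sym2.eq_swap (a := p 0) ▸ R.pw_next 0 1 rfl t0
  have e31 : s(w 0, p 3) ∈ g 1 := Sym2.eq_swap (a := p 3) ▸ g1 ▸ h1 ▸ R.pw 3 t3
  have e34 : s(w 0, p 3) ∈ g 4 := Sym2.eq_swap (a := p 3) ▸ h1 ▸ R.pw_next 3 4 rfl t3
  have e54 : s(w 5, p 5) ∈ g 4 := Sym2.eq_swap (a := p 5) ▸ g4 ▸ R.pw 5 t5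
  have e56 : s(w 5, p 5) ∈ g 6 := Sym2.eq_swap (a := p 5) ▸ R.pw_next 5 6 rfl t5
  have e86 : s(w 5, p 8) ∈ g 6 := Sym2.eq_swap (a := p 8) ▸ g8 ▸ h2 ▸ R.pw 8 t8
  have e89 : s(w 5, p 8) ∈ g 9 := Sym2.eq_swap (a := p 8) ▸ h2 ▸ R.pw_next 8 9 rfl t8
  have hmm : w 0 ≠ w 5 := by
    intro h
    rw [← h] at e54 e86
    have := hF.adj_eq (hF.face_adj (R.g_mem _) e00) (hF.face_adj (R.g_mem _) e31)
      (hF.face_adj (R.g_mem _) e54) p03 p05 p35 (hF.face_adj (R.g_mem _) e86)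
    grind
  have haa := R.a_ne (i := 4) (j := 5) (by decide)
  have hap := R.a_ne_p
  have haw := R.a_ne_w
  have close : s(w 5, w 0) ∈ g 4 := hF.face_path_six (R.g_mem 4)
    (by simp; grind) e34 (R.pa 3 4 rfl t3) (R.edge 4 5 rfl t4) (g4 ▸ R.ap 5 t5)
      (Sym2.eq_swap (a := p 5) ▸ e54)
  have close' : s(w 0, w 5) ∈ g 4 := Sym2.eq_swap (a := w 5) ▸ close
  have adj := hF.face_adj (R.g_mem _) close'
  have f0 : s(w 0, w 5) ∈ g 0 := hF.third_edge (R.g_mem 1) (R.g_mem 0)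
    (R.g_ne hF rfl t0).symm e01 e00 e31 p03.symm adj (hm' 0 t0) (hm' 3 t3)
  have f9 : s(w 5, w 0) ∈ g 9 := hF.third_edge (R.g_mem 6) (R.g_mem 9)
    (g8 ▸ R.g_ne hF rfl t8) e86 e89 e56 p58 adj.symm (hm 8 t8) (hm 5 t5)
  have n40 : g 4 ≠ g 0 := hF.face_ne (R.g_mem 4) e34 close' (hm' 3 t3).symm e00 p03 (hm' 0 t0).symm
  have n49 : g 4 ≠ g 9 := hF.face_ne (R.g_mem 4) e54 close (hm 5 t5).symm e89 p58.symm (hm 8 t8).symm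
  have g09 : g 0 = g 9 := hF.edge_faces (R.g_mem 4) (R.g_mem 0) (R.g_mem 9) close' f0
    (Sym2.eq_swap (a := w 5) ▸ f9) n40 n49
  obtain ⟨x, hx, hx'⟩ := R.exists_prev (i := 10) (j := 0) rfl
  have a09 := R.a_ne (i := 0) (j := 9) (by decide)
  have a10 := R.a_ne (i := 10) (j := 9) (by decide)
  have a100 := R.a_ne (i := 10) (j := 0) (by decide)
  have hx0 : x ≠ p 0 := by
    rcases hx' with ⟨h, rfl⟩ | ⟨h, rfl⟩
    exacts [R.p_ne h t0 (by decide), R.a_ne_p _ _ t0]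
  have hx8 : x ≠ p 8 := by
    rcases hx' with ⟨h, rfl⟩ | ⟨h, rfl⟩
    exacts [R.p_ne h t8 (by decide), R.a_ne_p _ _ t8]
  exact hF.face_path_seven (R.g_mem 0) (by simp; grind) hx (R.ap 0 t0)
    (R.pw 0 t0) f0 (g09 ▸ e89) (g09 ▸ R.pa 8 9 rfl t8)

theorem w_ne_p_symm (R : RingSide faces S t a p w g) (hF : IsFullerene G faces) {i j : ZMod 11}
    (hi : t i = true) (hj : t j = true) (h : w i ≠ p j) : w j ≠ p i := by
  intro hw
  have hx := hF.adj_eq (hF.face_adj (R.g_mem i) (R.ap i hi)).symm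
    (hF.face_adj (R.g_mem (i + 1)) (R.pa i _ rfl hi)) (hF.face_adj (R.g_mem i) (R.pw i hi))
    (R.a_ne (ne_succ i)) (R.a_ne_w _ _ hi) (R.a_ne_w _ _ hi)
    (hw ▸ (hF.face_adj (R.g_mem j) (R.pw j hj)).symm)
  have := R.a_ne_p i j hj
  have := R.a_ne_p (i + 1) j hj
  grind

theorem not_gaps_two_three_two (R : RingSide faces S t a p w g) (hF : IsFullerene G faces)
    (hc : (Finset.univ.filter fun i => t i = true).card ≤ 5) :
    ¬ (t 0 = true ∧ t 1 = false ∧ t 2 = false ∧ t 3 = true ∧ t 4 = false ∧ t 5 = true ∧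
      t 9 = true ∧ t 10 = false) := by
  rintro ⟨t0, t1, t2, t3, t4, t5, t9, t10⟩
  obtain ⟨-, h1, -⟩ := R.hexagon_of_gap_three hF hc (i := 0) (j := 1) rfl rfl rfl t0 t1 t2 t3
  have hm := R.w_ne_p hF t0 t3 (by decide) h1
  have p03 := R.p_ne t0 t3 (by decide)
  have p35 := R.p_ne t3 t5 (by decide)
  have p05 := R.p_ne t0 t5 (by decide)
  have p09 := R.p_ne t0 t9 (by decide)
  have p39 := R.p_ne t3 t9 (by decide)
  have g1 : g 3 = g 1 := (R.g_eq 2 3 rfl t2).trans (R.g_eq 1 2 rfl t1)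
  have g4 : g 5 = g 4 := R.g_eq 4 5 rfl t4
  have g10 : g 0 = g 10 := R.g_eq 10 0 rfl t10
  have e00 : s(w 0, p 0) ∈ g 10 := Sym2.eq_swap (a := p 0) ▸ g10 ▸ R.pw 0 t0
  have e01 : s(w 0, p 0) ∈ g 1 := Sym2.eq_swap (a := p 0) ▸ R.pw_next 0 1 rfl t0
  have e31 : s(w 0, p 3) ∈ g 1 := Sym2.eq_swap (a := p 3) ▸ g1 ▸ h1 ▸ R.pw 3 t3
  have e34 : s(w 0, p 3) ∈ g 4 := Sym2.eq_swap (a := p 3) ▸ h1 ▸ R.pw_next 3 4 rfl t3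
  have e54 : s(a 5, p 5) ∈ g 4 := g4 ▸ R.ap 5 t5
  have f54 : s(p 5, w 5) ∈ g 4 := g4 ▸ R.pw 5 t5
  have e910 := R.pa 9 10 rfl t9
  have f910 : s(p 9, w 9) ∈ g 10 := R.pw_next 9 10 rfl t9
  have haa := R.a_ne (i := 4) (j := 5) (by decide)
  have haa' := R.a_ne (i := 10) (j := 0) (by decide)
  have hap := R.a_ne_p
  have haw := R.a_ne_w
  have z5 : s(w 5, w 0) ∈ g 4 := by
    refine (hF.face_path_next (R.g_mem 4) (by simp; grind) e34 (R.pa 3 4 rfl t3)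
      (R.edge 4 5 rfl t4) e54 f54 (haw 5 5 t5).symm).resolve_left fun hw => ?_
    exact R.false_of_vee hF (h := 10) (i := 0) (j := 1) (k := 5) (l := 6) (n := 7) (m := p 3)
      rfl rfl rfl rfl (by decide) t0 t5 hw.symm e31 (g4 ▸ e34) p03.symm p35
  have z9 : s(w 9, w 0) ∈ g 10 := by
    refine (hF.face_path_next (R.g_mem 10) (by simp; grind) e00
      (Sym2.eq_swap (a := a 0) ▸ g10 ▸ R.ap 0 t0)
      (Sym2.eq_swap (a := a 10) ▸ R.edge 10 0 rfl t10) (Sym2.eq_swap (a := p 9) ▸ e910) f910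
      (haw 10 9 t9).symm).resolve_left fun hw => ?_
    exact R.false_of_vee hF (h := 8) (i := 9) (j := 10) (k := 3) (l := 4) (n := 5) (m := p 0)
      rfl rfl rfl rfl (by decide) t9 t3 (hw.trans h1) (hw ▸ e00) (hw ▸ g1 ▸ e01) p09 p03
  have a0 := hF.face_adj (R.g_mem _) e00
  have a3 := hF.face_adj (R.g_mem _) e31
  have a5 := (hF.face_adj (R.g_mem _) z5).symm
  have a9 := (hF.face_adj (R.g_mem _) z9).symm
  have w50 := R.w_ne_p_symm hF t0 t5 (hm 5 t5)
  have w53 := R.w_ne_p_symm hF t3 t5 (h1 ▸ hm 5 t5)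
  have w90 := R.w_ne_p_symm hF t0 t9 (hm 9 t9)
  have w93 := R.w_ne_p_symm hF t3 t9 (h1 ▸ hm 9 t9)
  have h95 : w 9 = w 5 :=
    ((hF.adj_eq a0 a3 a5 p03 w50.symm w53.symm a9).resolve_left w90).resolve_left w93
  exact R.false_of_vee hF (h := 8) (i := 9) (j := 10) (k := 5) (l := 6) (n := 7) (m := w 0)
    rfl rfl rfl rfl (by decide) t9 t5 h95 z9 (h95 ▸ g4 ▸ z5) (hm 9 t9) (hm 5 t5)

theorem word (R : RingSide faces S t a p w g) (hF : IsFullerene G faces)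
    (hc : (Finset.univ.filter fun i => t i = true).card ≤ 5) :
    ∃ k, t (0 + k) = true ∧ t (1 + k) = false ∧ t (2 + k) = false ∧ t (3 + k) = true ∧
      t (4 + k) = true ∧ t (5 + k) = false ∧ t (6 + k) = false ∧ t (7 + k) = true ∧
      t (8 + k) = false ∧ t (9 + k) = true ∧ t (10 + k) = false := by
  have hc' (k : ZMod 11) : (Finset.univ.filter fun i => t (i + k) = true).card ≤ 5 := by
    rwa [card_shift]
  exact ring_word t hc
    (fun k => (R.shift k).not_four_false hF (h := 10) (i := 0) (j := 1) (k := 2) (l := 3) (m := 4)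
      (n := 5) rfl rfl rfl rfl rfl rfl (by decide))
    (fun k => (R.shift k).not_gap_four hF (hc' k))
    (fun k => (R.shift k).not_two_gaps_three hF (hc' k))
    (fun k => (R.shift k).not_gaps_two_three_two hF (hc' k))
    (fun k => (R.shift k).not_gaps_three_two_three hF (hc' k))

end RingSide

namespace RingSide

variable {V : Type*} [Fintype V] [DecidableEq V] {G : SimpleGraph V}
  {faces : Finset (Finset (Sym2 V))} {S S' : Set V}
  {t : ZMod 11 → Bool} {a p w b q x : ZMod 11 → V} {g g' : ZMod 11 → Finset (Sym2 V)}

theorem not_adj_of_altFace (hF : IsFullerene G faces) {M : G.Subgraph} (hM : M.IsMatching)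
    {f : Finset (Sym2 V)} (hf : f ∈ faces) (hA : AltFace G M f) {v c d u : V}
    (hc : s(v, c) ∈ f) (hd : s(v, d) ∈ f) (hcd : c ≠ d) (huc : u ≠ c) (hud : u ≠ d) :
    ¬ M.Adj u v := by
  intro h
  obtain ⟨y, hy, hy'⟩ := hA v ⟨_, hc, by simp⟩
  have := (hM h.snd_mem).unique hy' h.symm
  subst this
  rcases hF.face_two hf hc hd hcd hy <;> grind

theorem not_resonant_of_word (A : RingSide faces S t a p w g)
    (B : RingSide faces S' (fun i => !t i) b q x g') (hF : IsFullerene G faces)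
    (hS : Disjoint S S') (hab : ∀ i, G.Adj (a i) (b i))
    (hc : (Finset.univ.filter fun i => t i = true).card ≤ 5)
    (t0 : t 0 = true) (t1 : t 1 = false) (t2 : t 2 = false) (t3 : t 3 = true) (t4 : t 4 = true)
    (t5 : t 5 = false) (t6 : t 6 = false) (t7 : t 7 = true) : ¬ KResonant G faces 3 := by
  obtain ⟨c1, w1, v1⟩ := A.hexagon_of_gap_three hF hc (i := 0) (j := 1) (k := 2) (l := 3)
    rfl rfl rfl t0 t1 t2 t3
  obtain ⟨c5, w5, v5⟩ := A.hexagon_of_gap_three hF hc (i := 4) (j := 5) (k := 6) (l := 7)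
    rfl rfl rfl t4 t5 t6 t7
  obtain ⟨c3, -, v3⟩ := (B.gap_three hF (i := 2) (j := 3) (k := 4) (l := 5) rfl rfl rfl (by decide)
    (by simp [t2]) (by simp [t3]) (by simp [t4]) (by simp [t5])).resolve_left fun c => by
      have c' : Chord (fun i => !t i) q x g' 1 6 := B.chord_step hF (h := 0) (m := 7) (n := 8) c
        rfl rfl rfl rfl rfl (by decide) (by decide)
      have c'' : Chord (fun i => !t i) q x g' 0 7 := B.chord_step hF (h := 10) (m := 8) (n := 9) c'
        rfl rfl rfl rfl rfl (by decide) (by decide)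
      have := c''.left
      simp [t0] at this
  have g1 : g 3 = g 1 := (A.g_eq 2 3 rfl t2).trans (A.g_eq 1 2 rfl t1)
  have g7 : g 7 = g 5 := (A.g_eq 6 7 rfl t6).trans (A.g_eq 5 6 rfl t5)
  have g3 : g' 4 = g' 3 := B.g_eq 3 4 rfl (by simp [t3])
  have s1 : faceVerts (g 1) ⊆ S := fun y hy => by
    rcases v1 y hy with rfl | rfl | rfl | rfl | rfl | rfl
    exacts [A.p_mem _ t0, A.a_mem _, A.a_mem _, A.a_mem _, A.p_mem _ t3, A.w_mem _ t3]
  have s5 : faceVerts (g 5) ⊆ S := fun y hy => by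
    rcases v5 y hy with rfl | rfl | rfl | rfl | rfl | rfl
    exacts [A.p_mem _ t4, A.a_mem _, A.a_mem _, A.a_mem _, A.p_mem _ t7, A.w_mem _ t7]
  have s3 : faceVerts (g' 3) ⊆ S' := fun y hy => by
    rcases v3 y hy with rfl | rfl | rfl | rfl | rfl | rfl
    exacts [B.p_mem _ (by simp [t2]), B.a_mem _, B.a_mem _, B.a_mem _, B.p_mem _ (by simp [t5]),
      B.w_mem _ (by simp [t5])]
  have hm := A.w_ne_p hF t0 t3 (by decide) w1
  have hm' := A.w_ne_p hF t4 t7 (by decide) w5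
  have hap := A.a_ne_p
  have haw := A.a_ne_w
  have p03 := A.p_ne t0 t3 (by decide)
  have p04 := A.p_ne t0 t4 (by decide)
  have p07 := A.p_ne t0 t7 (by decide)
  have p34 := A.p_ne t3 t4 (by decide)
  have p37 := A.p_ne t3 t7 (by decide)
  have p47 := A.p_ne t4 t7 (by decide)
  have w04 : w 0 ≠ w 4 := by
    intro h
    have e0 := hF.face_adj (A.g_mem 0) (A.pw 0 t0)
    have e3 := hF.face_adj (A.g_mem 3) (A.pw 3 t3)
    have e4 := hF.face_adj (A.g_mem 4) (A.pw 4 t4)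
    have e7 := hF.face_adj (A.g_mem 7) (A.pw 7 t7)
    rw [← w1] at e3
    rw [← h] at e4
    rw [← w5, ← h] at e7
    have := hF.adj_eq e0.symm e3.symm e4.symm p03 p04 p34 e7.symm
    grind
  have d15 : Disjoint (faceVerts (g 1)) (faceVerts (g 5)) := by
    have han : [a 1, a 2, a 3, a 5, a 6, a 7].Nodup :=
      List.Nodup.map A.a_inj (l := [1, 2, 3, 5, 6, 7]) (by decide)
    simp only [List.nodup_cons, List.mem_cons, List.not_mem_nil, or_false, not_or] at han
    refine Set.disjoint_left.2 fun y hy hy' => ?_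
    rcases v1 y hy with rfl | rfl | rfl | rfl | rfl | rfl <;>
      rcases v5 _ hy' with h | h | h | h | h | h <;> grind
  have d13 : Disjoint (faceVerts (g 1)) (faceVerts (g' 3)) := hS.mono s1 s3
  have d53 : Disjoint (faceVerts (g 5)) (faceVerts (g' 3)) := hS.mono s5 s3
  intro hR
  obtain ⟨M, ⟨hM, hM'⟩, hA⟩ := hR {g 1, g 5, g' 3}
    (by simp [Finset.insert_subset_iff, A.g_mem, B.g_mem])
    (by simp [c1, c5, c3])
    (by simp [d15, d13, d53, d15.symm, d13.symm, d53.symm])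
    Finset.card_le_three
  obtain ⟨u, hu, -⟩ := hM (hM' (a 4))
  have hSab : ∀ y ∈ S, ∀ i, y ≠ b i := fun y hy i h =>
    Set.disjoint_left.1 hS hy (h ▸ B.a_mem i)
  have a34 := A.a_ne (i := 4) (j := 3) (by decide)
  have a45 := A.a_ne (i := 4) (j := 5) (by decide)
  rcases hF.adj_eq (hF.face_adj (A.g_mem 4) (A.pa 3 4 rfl t3)).symm
    (hF.face_adj (A.g_mem 4) (A.ap 4 t4)) (hab 4) p34 (hSab _ (A.p_mem _ t3) 4)
    (hSab _ (A.p_mem _ t4) 4) hu.adj_sub with rfl | rfl | rfl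
  · exact not_adj_of_altFace hF hM (A.g_mem 1) (hA _ (by simp)) (c := a 3) (d := w 3)
      (Sym2.eq_swap (a := a 3) ▸ g1 ▸ A.ap 3 t3) (g1 ▸ A.pw 3 t3) (haw _ _ t3) a34 (haw _ _ t3) hu
  · exact not_adj_of_altFace hF hM (A.g_mem 5) (hA _ (by simp)) (c := a 5) (d := w 4)
      (A.pa 4 5 rfl t4) (A.pw_next 4 5 rfl t4) (haw _ _ t4) a45 (haw _ _ t4) hu
  · exact not_adj_of_altFace hF hM (B.g_mem 3) (hA _ (by simp)) (c := b 3) (d := b 5)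
      (Sym2.eq_swap (a := b 3) ▸ B.edge 3 4 rfl (by simp [t3]))
      (g3 ▸ B.edge 4 5 rfl (by simp [t4])) (B.a_ne (by decide)) (hSab _ (A.a_mem 4) 3)
      (hSab _ (A.a_mem 4) 5) hu

theorem not_resonant (A : RingSide faces S t a p w g)
    (B : RingSide faces S' (fun i => !t i) b q x g') (hF : IsFullerene G faces)
    (hS : Disjoint S S') (hab : ∀ i, G.Adj (a i) (b i))
    (hc : (Finset.univ.filter fun i => t i = true).card ≤ 5) : ¬ KResonant G faces 3 := by
  obtain ⟨k, t0, t1, t2, t3, t4, t5, t6, t7, -⟩ := A.word hF hc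
  exact (A.shift k).not_resonant_of_word (B.shift k) hF hS (fun i => hab (i + k))
    (by rw [card_shift]; exact hc) t0 t1 t2 t3 t4 t5 t6 t7

end RingSide

section Assembly

variable {V : Type*} [Fintype V] [DecidableEq V] {G : SimpleGraph V}
  {faces : Finset (Finset (Sym2 V))}

theorem exists_ringSide (hF : IsFullerene G faces) {R : ZMod 11 → Finset (Sym2 V)}
    (hR : IsPentagonalRing faces 11 R) {S : Set V} {a b p : ZMod 11 → V} {t : ZMod 11 → Bool}
    (he : ∀ i, R i ∩ R (i + 1) = {s(a i, b i)}) (aS : ∀ i, a i ∈ S) (bS : ∀ i, b i ∉ S)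
    (hS : ∀ u v, G.Adj u v → u ∈ S → v ∉ S → ∃ i, u = a i ∧ v = b i)
    (hI : ∀ i, t i = true → s(a i, p i) ∈ R (i + 1) ∧ s(p i, a (i + 1)) ∈ R (i + 1) ∧ p i ≠ b i)
    (hO : ∀ i, t i = false → s(a i, a (i + 1)) ∈ R (i + 1)) :
    ∃ w g, RingSide faces S t a p w g := by
  obtain ⟨-, -, hmem, -, hdisj, hmatch⟩ := hR
  replace hmem i := (hmem i).1
  have ab_mem (i) : s(a i, b i) ∈ R i ∩ R (i + 1) := by rw [he]; simp
  have ab_left (i) := (Finset.mem_inter.1 (ab_mem i)).1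
  have ab_right (i) := (Finset.mem_inter.1 (ab_mem i)).2
  have a_inj : Function.Injective a := fun i j h => by
    by_contra hij
    exact hmatch i j hij _ (ab_mem i) _ (ab_mem j) (a i) (by simp) (by simp [h])
  have pS (i) (hi : t i = true) : p i ∈ S := by
    by_contra h
    obtain ⟨h1, -, h3⟩ := hI i hi
    obtain ⟨j, hj, hj'⟩ := hS _ _ (hF.face_adj (hmem _) h1) (aS i) h
    exact h3 (a_inj hj ▸ hj')
  have not_shared {i : ZMod 11} {v : V} (hv : v ∈ S) (h1 : s(a i, v) ∈ R i)
      (h2 : s(a i, v) ∈ R (i + 1)) : False := by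
    have h := Finset.mem_inter.2 ⟨h1, h2⟩
    rw [he, Finset.mem_singleton, Sym2.congr_right] at h
    exact bS i (h ▸ hv)
  have vert {i : ZMod 11} {u v : V} (h : s(u, v) ∈ R i) : u ∈ faceVerts (R i) := ⟨_, h, by simp⟩
  have disj {i j : ZMod 11} {v : V} (hi : v ∈ faceVerts (R i)) (hj : v ∈ faceVerts (R j)) :
      j = i ∨ j = i + 1 ∨ j = i - 1 := by
    by_contra! h
    exact Set.disjoint_left.1 (hdisj i j h.1 h.2.1 h.2.2) hi hj
  have p_vert (i) (hi : t i = true) : p i ∈ faceVerts (R (i + 1)) := vert (hI i hi).2.1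
  have a_ne_p (i j) (hj : t j = true) : a i ≠ p j := by
    intro h
    obtain ⟨h1, h2, -⟩ := hI j hj
    have n1 : i ≠ j := fun hij => (hF.face_adj (hmem _) h1).ne (hij ▸ h)
    have n2 : i ≠ j + 1 := fun hij => (hF.face_adj (hmem _) h2).ne (hij ▸ h.symm)
    have d1 := disj (p_vert j hj) (h ▸ vert (ab_left i))
    have d2 := disj (p_vert j hj) (h ▸ vert (ab_right i))
    clear * - n1 n2 d1 d2
    revert i j
    decide
  have p_ne_succ (i) (hi : t i = true) (hj : t (i + 1) = true) : p i ≠ p (i + 1) := by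
    intro h
    have h1 := (hI i hi).2.1
    rw [h, Sym2.eq_swap] at h1
    exact not_shared (pS _ hj) h1 (hI _ hj).1
  have p_inj (i j) (hi : t i = true) (hj : t j = true) (h : p i = p j) : i = j := by
    rcases disj (p_vert i hi) (h ▸ p_vert j hj) with hij | hij | hij
    · exact (add_right_cancel hij).symm
    · have hij : j = i + 1 := add_right_cancel hij
      subst hij
      exact (p_ne_succ i hi hj h).elim
    · have hij : i = j + 1 := by linear_combination -hij
      subst hij
      exact (p_ne_succ j hj hi h.symm).elim
  have key (i) : ∃ m n f, f ∈ faces ∧ m ∈ S ∧ n ∈ S ∧ m ≠ n ∧ s(a i, m) ∈ f ∧ s(a i, n) ∈ f ∧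
      f ≠ R i ∧ f ≠ R (i + 1) ∧ (t i = true → n = p i) ∧ (t i = false → n = a (i + 1)) ∧
      ∀ h, i = h + 1 → (t h = true → m = p h) ∧ (t h = false → m = a h) := by
    have hn : ∃ n ∈ S, s(a i, n) ∈ R (i + 1) ∧
        (t i = true → n = p i) ∧ (t i = false → n = a (i + 1)) := by
      cases h : t i
      · exact ⟨_, aS _, hO i h, by simp⟩
      · exact ⟨_, pS _ h, (hI i h).1, by simp⟩
    have hm : ∃ m ∈ S, s(a i, m) ∈ R i ∧
        ∀ h, i = h + 1 → (t h = true → m = p h) ∧ (t h = false → m = a h) := by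
      obtain ⟨k, rfl⟩ : ∃ k, i = k + 1 := ⟨i - 1, by ring⟩
      cases h : t k
      · refine ⟨_, aS k, Sym2.eq_swap (a := a k) ▸ hO k h, fun l hl => ?_⟩
        rw [← add_right_cancel hl]
        simp [h]
      · refine ⟨_, pS _ h, Sym2.eq_swap (a := p k) ▸ (hI k h).2.1, fun l hl => ?_⟩
        rw [← add_right_cancel hl]
        simp [h]
    obtain ⟨n, nS, n1, n2, n3⟩ := hn
    obtain ⟨m, mS, m1, m2⟩ := hm
    have hmn : m ≠ n := fun h => not_shared mS m1 (h ▸ n1)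
    have hmb : m ≠ b i := fun h => bS i (h ▸ mS)
    have hnb : n ≠ b i := fun h => bS i (h ▸ nS)
    obtain ⟨f, hf, f1, f2⟩ :=
      hF.corner_exists (hF.face_adj (hmem _) m1) (hF.face_adj (hmem _) n1) hmn
    exact ⟨m, n, f, hf, mS, nS, hmn, f1, f2,
      (hF.face_ne (hmem i) (ab_left i) m1 hmb.symm f2 hnb hmn.symm).symm,
      (hF.face_ne (hmem _) (ab_right i) n1 hnb.symm f1 hmb hmn).symm, n2, n3, m2⟩
  choose m n g g_mem mS nS hmn gm gn gl gr nt nf mt using key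
  choose w w1 w2 w3 using fun i => hF.exists_third (p i) (a i) (a (i + 1))
  have ap (i) (hi : t i = true) : s(a i, p i) ∈ g i := nt i hi ▸ gn i
  have pa (i j) (hj : j = i + 1) (hi : t i = true) : s(p i, a j) ∈ g j := by
    rw [Sym2.eq_swap, ← (mt j i hj).1 hi]
    exact gm j
  have edge (i j) (hj : j = i + 1) (hi : t i = false) : s(a i, a j) ∈ g i := by
    rw [hj, ← nf i hi]
    exact gn i
  have a_succ (i) : a i ≠ a (i + 1) := a_inj.ne (RingSide.ne_succ i)
  have a_ne_w (i j) (hj : t j = true) : a i ≠ w j := by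
    intro h
    have hadj : G.Adj (a i) (p j) := h ▸ (w1 j).symm
    have hb := hF.face_adj (hmem i) (ab_left i)
    rcases hF.adj_eq (hF.face_adj (g_mem i) (gm i)) (hF.face_adj (g_mem i) (gn i)) hb (hmn i)
      (fun h => bS i (h ▸ mS i)) (fun h => bS i (h ▸ nS i)) hadj with h' | h' | h'
    · obtain ⟨k, rfl⟩ : ∃ k, i = k + 1 := ⟨i - 1, by ring⟩
      cases hk : t k
      · exact a_ne_p k j hj (h'.trans ((mt _ k rfl).2 hk)).symm
      · have := p_inj _ _ hj hk (h'.trans ((mt _ k rfl).1 hk))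
        subst this
        exact w3 j h.symm
    · cases hi : t i
      · exact a_ne_p _ j hj (h'.trans (nf i hi)).symm
      · have := p_inj _ _ hj hi (h'.trans (nt i hi))
        subst this
        exact w2 j h.symm
    · exact bS i (h' ▸ pS j hj)
  refine ⟨w, g, g_mem, a_inj, a_ne_p, p_inj, a_ne_w, aS, pS, fun j hj => ?_, edge,
    fun i j hj hi => ?_, ap, fun i hi => ?_, fun i j hj hi => ?_, pa⟩
  · by_contra h
    obtain ⟨k, hk, -⟩ := hS _ _ (w1 j) (pS j hj) h
    exact a_ne_p k j hj hk.symm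
  · refine hF.edge_faces (hmem j) (g_mem j) (g_mem i) (hj ▸ hO i hi) ?_ (edge i j hj hi)
      (gl j).symm (hj ▸ gr i).symm
    rw [Sym2.eq_swap, ← (mt j i hj).2 hi]
    exact gm j
  · obtain ⟨h1, h2, -⟩ := hI i hi
    exact hF.third_edge (hmem (i + 1)) (g_mem i) (gr i).symm (Sym2.eq_swap (a := a i) ▸ h1)
      (Sym2.eq_swap (a := a i) ▸ ap i hi) h2 (a_succ i).symm (w1 i) (w2 i) (w3 i)
  · subst hj
    obtain ⟨h1, h2, -⟩ := hI i hi
    exact hF.third_edge (hmem (i + 1)) (g_mem _) (gl _).symm h2 (pa i _ rfl hi)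
      (Sym2.eq_swap (a := a i) ▸ h1) (a_succ i) (w1 i) (w3 i) (w2 i)

/-- The shared edges of a pentagonal ring form an edge cut. -/
theorem exists_ring_cut (hF : IsFullerene G faces) {R : ZMod 11 → Finset (Sym2 V)}
    (hR : IsPentagonalRing faces 11 R) :
    ∃ (a b : ZMod 11 → V) (S : Set V), (∀ i, R i ∩ R (i + 1) = {s(a i, b i)}) ∧ (∀ i, a i ∈ S) ∧
      (∀ i, b i ∉ S) ∧ ∀ u v, G.Adj u v → u ∈ S → v ∉ S → ∃ i, u = a i ∧ v = b i := by
  obtain ⟨-, hinj, hmem, hone, -, hmatch⟩ := hR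
  replace hmem i := (hmem i).1
  choose e he using hone
  have he_mem (i) : e i ∈ R i ∩ R (i + 1) := by rw [he]; simp
  have he_left (i) := (Finset.mem_inter.1 (he_mem i)).1
  have he_right (i) := (Finset.mem_inter.1 (he_mem i)).2
  have e_face {f} (hf : f ∈ faces) {j} (h : e j ∈ f) : f = R j ∨ f = R (j + 1) := by
    by_contra! h'
    exact RingSide.ne_succ j (hinj (hF.edge_faces hf (hmem j) (hmem (j + 1)) h (he_left j)
      (he_right j) h'.1 h'.2))
  have e_ne (i) : e i ≠ e (i + 1) := by
    intro h
    obtain ⟨v, hv⟩ : ∃ v, v ∈ e i := by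
      induction e i using Sym2.ind with
      | _ x y => exact ⟨x, by simp⟩
    exact hmatch i (i + 1) (RingSide.ne_succ i) _ (he_mem i) _ (he_mem _) v hv (h ▸ hv)
  have hD : ∀ f ∈ faces, Even (Finset.univ.image e ∩ f).card := by
    intro f hf
    by_cases hfR : ∃ i, f = R (i + 1)
    · obtain ⟨i, rfl⟩ := hfR
      have : Finset.univ.image e ∩ R (i + 1) = {e i, e (i + 1)} := by
        ext x
        simp only [Finset.mem_inter, Finset.mem_image, Finset.mem_univ, true_and,
          Finset.mem_insert, Finset.mem_singleton]
        constructor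
        · rintro ⟨⟨j, rfl⟩, hj⟩
          rcases e_face hf hj with h | h
          · exact Or.inr (by rw [hinj h])
          · exact Or.inl (by rw [add_right_cancel (hinj h)])
        · rintro (rfl | rfl)
          exacts [⟨⟨i, rfl⟩, he_right i⟩, ⟨⟨i + 1, rfl⟩, he_left _⟩]
      rw [this, Finset.card_pair (e_ne i)]
      decide
    · have : Finset.univ.image e ∩ f = ∅ := by
        ext x
        simp only [Finset.mem_inter, Finset.mem_image, Finset.mem_univ, true_and,
          Finset.notMem_empty, iff_false, not_and]
        rintro ⟨j, rfl⟩ hj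
        rcases e_face hf hj with h | h
        · exact hfR ⟨j - 1, by rw [h]; ring_nf⟩
        · exact hfR ⟨j, h⟩
      simp [this]
  obtain ⟨χ, hχ⟩ := hF.exists_cut _ hD
  have ends (i) : ∃ u v, e i = s(u, v) ∧ χ u = 0 ∧ χ v ≠ 0 := by
    obtain ⟨u, v, huv⟩ : ∃ u v, e i = s(u, v) := by
      induction e i using Sym2.ind with
      | _ x y => exact ⟨x, y, rfl⟩
    have hadj := hF.face_adj (hmem i) (huv ▸ he_left i)
    have hne := (hχ u v hadj).1 (by rw [← huv]; simp)
    by_cases hu : χ u = 0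
    · exact ⟨u, v, huv, hu, fun hv => hne (hu.trans hv.symm)⟩
    · refine ⟨v, u, huv.trans Sym2.eq_swap, ?_, hu⟩
      generalize χ u = x at *
      generalize χ v = y at *
      clear * - hne hu
      revert x y
      decide
  choose a b hab ha hb using ends
  refine ⟨a, b, {v | χ v = 0}, fun i => by rw [he, hab], ha, hb, fun u v huv hu hv => ?_⟩
  have h := (hχ u v huv).2 fun h => hv (h.symm.trans hu)
  simp only [Finset.mem_image, Finset.mem_univ, true_and] at h
  obtain ⟨i, hi⟩ := h
  rw [hab, Sym2.eq_iff] at hi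
  rcases hi with ⟨rfl, rfl⟩ | ⟨rfl, rfl⟩
  · exact ⟨i, rfl, rfl⟩
  · exact (hb i hu).elim

/-- In each pentagon of a ring, the apex lies on exactly one side. -/
theorem exists_apex (hF : IsFullerene G faces) {R : ZMod 11 → Finset (Sym2 V)}
    (hR : IsPentagonalRing faces 11 R) {S : Set V} {a b : ZMod 11 → V}
    (he : ∀ i, R i ∩ R (i + 1) = {s(a i, b i)}) (aS : ∀ i, a i ∈ S) (bS : ∀ i, b i ∉ S)
    (hS : ∀ u v, G.Adj u v → u ∈ S → v ∉ S → ∃ i, u = a i ∧ v = b i) (i : ZMod 11) :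
    (∃ p, (s(a i, p) ∈ R (i + 1) ∧ s(p, a (i + 1)) ∈ R (i + 1) ∧ p ≠ b i) ∧
      s(b i, b (i + 1)) ∈ R (i + 1)) ∨
    (∃ q, (s(b i, q) ∈ R (i + 1) ∧ s(q, b (i + 1)) ∈ R (i + 1) ∧ q ≠ a i) ∧
      s(a i, a (i + 1)) ∈ R (i + 1)) := by
  obtain ⟨-, -, hmem, -, -, hmatch⟩ := hR
  have ab_mem (i) : s(a i, b i) ∈ R i ∩ R (i + 1) := by rw [he]; simp
  have hne {i j : ZMod 11} (hij : i ≠ j) : a i ≠ a j ∧ a i ≠ b j ∧ b i ≠ a j ∧ b i ≠ b j := by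
    have h1 := hmatch i j hij _ (ab_mem i) _ (ab_mem j) (a i) (by simp)
    have h2 := hmatch i j hij _ (ab_mem i) _ (ab_mem j) (b i) (by simp)
    simp only [Sym2.mem_iff, not_or] at h1 h2
    exact ⟨h1.1, h1.2, h2⟩
  have no_cross {i j : ZMod 11} (hij : i ≠ j) : ¬ G.Adj (a i) (b j) := fun h => by
    obtain ⟨k, hk, hk'⟩ := hS _ _ h (aS i) (bS j)
    have hik : i = k := by
      by_contra h
      exact (hne h).1 hk
    have hjk : j = k := by
      by_contra h
      exact (hne h).2.2.2 hk'
    exact hij (hik.trans hjk.symm)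
  have hsucc := RingSide.ne_succ i
  obtain ⟨n1, n2, n3, n4⟩ := hne hsucc
  have hi := (Finset.mem_inter.1 (ab_mem i)).2
  have hi' := (Finset.mem_inter.1 (ab_mem (i + 1))).1
  have hadj {u v : V} (h : s(u, v) ∈ R (i + 1)) := hF.face_adj (hmem _).1 h
  rcases hF.face_cyclic (hmem (i + 1)).1 hi with ⟨-, c, d, e, hn, hf⟩ | ⟨h6, -⟩
  swap
  · rw [(hmem (i + 1)).2] at h6
    omega
  simp only [List.nodup_cons, List.mem_cons, List.not_mem_nil, or_false, not_or] at hn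
  have e1 : s(b i, c) ∈ R (i + 1) := by simp [hf]
  have e2 : s(c, d) ∈ R (i + 1) := by simp [hf]
  have e3 : s(d, e) ∈ R (i + 1) := by simp [hf]
  have e4 : s(e, a i) ∈ R (i + 1) := by simp [hf]
  rw [hf] at hi'
  simp only [Finset.mem_insert, Finset.mem_singleton, Sym2.eq_iff] at hi'
  rcases hi' with (h | h) | (h | h) | (⟨rfl, rfl⟩ | ⟨rfl, rfl⟩) | (⟨rfl, rfl⟩ | ⟨rfl, rfl⟩) | (h | h)
  · exact (n1 h.1.symm).elim
  · exact (n2 h.2.symm).elim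
  · exact (n3 h.1.symm).elim
  · exact (n4 h.2.symm).elim
  · exact (no_cross hsucc.symm (hadj e1).symm).elim
  · exact Or.inl ⟨e, ⟨Sym2.eq_swap (a := e) ▸ e4, Sym2.eq_swap (b := e) ▸ e3, by grind⟩, e1⟩
  · exact (no_cross hsucc (hadj e4).symm).elim
  · exact Or.inr ⟨c, ⟨e1, e2, by grind⟩, Sym2.eq_swap (b := a i) ▸ e4⟩
  · exact (n2 h.2.symm).elim
  · exact (n1 h.1.symm).elim

end Assembly

/-- a fullerene graph whose minimum pentagonal ring length equals 11
is not 3-resonant. -/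
theorem tau_eleven_not_three_resonant {V : Type*} [Fintype V] [DecidableEq V]
    (G : SimpleGraph V) (faces : Finset (Finset (Sym2 V)))
    (hF : IsFullerene G faces)
    (hex : ∃ ring : ZMod 11 → Finset (Sym2 V), IsPentagonalRing faces 11 ring)
    (hmin : ∀ (l : ℕ) (ring : ZMod l → Finset (Sym2 V)),
      IsPentagonalRing faces l ring → 11 ≤ l) :
    ¬ KResonant G faces 3 := by
  obtain ⟨R, hR⟩ := hex
  obtain ⟨a, b, S, he, aS, bS, hS⟩ := exists_ring_cut hF hR
  have key (i) : ∃ (t : Bool) (p q : V),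
      (t = true → (s(a i, p) ∈ R (i + 1) ∧ s(p, a (i + 1)) ∈ R (i + 1) ∧ p ≠ b i) ∧
        s(b i, b (i + 1)) ∈ R (i + 1)) ∧
      (t = false → (s(b i, q) ∈ R (i + 1) ∧ s(q, b (i + 1)) ∈ R (i + 1) ∧ q ≠ a i) ∧
        s(a i, a (i + 1)) ∈ R (i + 1)) := by
    rcases exists_apex hF hR he aS bS hS i with ⟨p, h⟩ | ⟨q, h⟩
    · exact ⟨true, p, p, fun _ => h, by simp⟩
    · exact ⟨false, q, q, by simp, fun _ => h⟩
  choose t p q hI hO using key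
  obtain ⟨w, g, A⟩ := exists_ringSide hF hR he aS bS hS (fun i h => (hI i h).1)
    fun i h => (hO i h).2
  obtain ⟨x, g', B⟩ := exists_ringSide hF hR (S := Sᶜ) (a := b) (b := a) (p := q)
    (t := fun i => !t i) (fun i => by rw [he, Sym2.eq_swap]) bS (fun i => by simpa using aS i)
    (fun u v huv hu hv => by
      obtain ⟨i, h, h'⟩ := hS v u huv.symm (by simpa using hv) hu
      exact ⟨i, h', h⟩)
    (fun i h => (hO i (by simpa using h)).1) fun i h => (hI i (by simpa using h)).2
  have hab (i) : G.Adj (a i) (b i) := by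
    have h : s(a i, b i) ∈ R i ∩ R (i + 1) := by rw [he]; simp
    exact hF.face_adj (hR.2.2.1 i).1 (Finset.mem_inter.1 h).1
  have hcount := Finset.card_filter_add_card_filter_not (s := Finset.univ) (fun i => t i = true)
  rw [Finset.card_univ, ZMod.card] at hcount
  by_cases hc : (Finset.univ.filter fun i => t i = true).card ≤ 5
  · exact A.not_resonant B hF disjoint_compl_right hab hc
  · refine B.not_resonant (by simpa using A) hF disjoint_compl_left (fun i => (hab i).symm) ?_
    simp only [Bool.not_eq_true', Bool.not_eq_true] at hcount ⊢
    omega
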